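/- arXiv:math/0410454 — 2 statements merged into one kernel-verified Lean document; each statement's English description precedes it below -/
import Mathlib

section
/- For every element w of B⁺ there exist a unique integer n ≥ 0 and a unique element y of the following list such that w is conjugate in the braid group B to π^n·y: (i) 𝐬^a with a ≥ 0; (ii) 𝐬𝐭; (iii) 𝐬^{a₁}𝐭^{a₂}𝐬^{a₃}⋯𝐬^{a_{2k−1}}𝐭^{a_{2k}} with k ≥ 1, all a_i ≥ 2, and the sequence (a₁, …, a_{2k}) lexicographically greater than or equal to each of its cyclic shifts (a_{1+d}, a_{2+d}, …) (indices taken mod 2k), for every d; (iv) 𝐰₀𝐬^a with a ∈ {0, 1}; (v) 𝐰₀𝐬^{a₁}𝐭^{a₂}𝐬^{a₃}⋯𝐭^{a_{2k−2}}𝐬^{a_{2k−1}} with k ≥ 1, all a_i ≥ 2, and the sequence (a₁, …, a_{2k−1}) lexicographically greater than or equal to each of its cyclic shifts (indices taken mod 2k−1). -/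
/-!
The Artin–Tits braid monoid `B⁺` of type `A₂`: two generators `𝐬, 𝐭` (indexed by
`true, false`) and the single relation `𝐬𝐭𝐬 = 𝐭𝐬𝐭`; the braid group `B` with the same
presentation; `𝐰₀ = 𝐬𝐭𝐬` and `π = 𝐰₀²`.
-/

/-- The braid relation `sts = tst` of type `A₂`. -/
def a2Rel : FreeMonoid Bool → FreeMonoid Bool → Prop := fun a b =>
  a = FreeMonoid.of true * FreeMonoid.of false * FreeMonoid.of true ∧
  b = FreeMonoid.of false * FreeMonoid.of true * FreeMonoid.of false

/-- The braid monoid `B⁺` of type `A₂`. -/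
abbrev A2Monoid := PresentedMonoid a2Rel

/-- The generators of `B⁺`. -/
def a2Gen (g : Bool) : A2Monoid := PresentedMonoid.of a2Rel g

/-- The generator `𝐬`. -/
def sB : A2Monoid := a2Gen true

/-- The generator `𝐭`. -/
def tB : A2Monoid := a2Gen false

/-- `𝐰₀ = 𝐬𝐭𝐬`. -/
def w0B : A2Monoid := sB * tB * sB

/-- `π = 𝐰₀²`. -/
def piB : A2Monoid := w0B * w0B

/-- The alternating product `g^{a₁}·g'^{a₂}·g^{a₃}⋯` in `B⁺` attached to a list of
exponents, starting with the generator `g`. -/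
def altPow : Bool → List ℕ → A2Monoid
  | _, [] => 1
  | g, a :: rest => a2Gen g ^ a * altPow (!g) rest

/-- A list is lexicographically greater than or equal to all of its cyclic shifts. -/
def CyclicallyMaximal (L : List ℕ) : Prop :=
  ∀ d : ℕ, ¬ List.Lex (· < ·) L (L.rotate d)

/-- Membership in the list of canonical representatives (i)–(v). -/
def Shape (y : A2Monoid) : Prop :=
  -- (i) `𝐬^a`, `a ≥ 0`
  (∃ a : ℕ, y = sB ^ a) ∨
  -- (ii) `𝐬𝐭`
  (y = sB * tB) ∨
  -- (iii) `𝐬^{a₁}𝐭^{a₂}⋯𝐬^{a_{2k-1}}𝐭^{a_{2k}}`, `k ≥ 1`, `a_i ≥ 2`, cyclically maximal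
  (∃ (k : ℕ) (L : List ℕ), 1 ≤ k ∧ L.length = 2 * k ∧ (∀ a ∈ L, 2 ≤ a) ∧
    CyclicallyMaximal L ∧ y = altPow true L) ∨
  -- (iv) `𝐰₀𝐬^a`, `a ∈ {0, 1}`
  (∃ a : ℕ, a ≤ 1 ∧ y = w0B * sB ^ a) ∨
  -- (v) `𝐰₀𝐬^{a₁}𝐭^{a₂}⋯𝐬^{a_{2k-1}}`, `k ≥ 1`, `a_i ≥ 2`, cyclically maximal
  (∃ (k : ℕ) (L : List ℕ), 1 ≤ k ∧ L.length = 2 * k - 1 ∧ (∀ a ∈ L, 2 ≤ a) ∧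
    CyclicallyMaximal L ∧ y = w0B * altPow true L)

/-- The relator `sts(tst)⁻¹` of the braid group of type `A₂`. -/
def a2Relators : Set (FreeGroup Bool) :=
  { FreeGroup.of true * FreeGroup.of false * FreeGroup.of true *
    (FreeGroup.of false * FreeGroup.of true * FreeGroup.of false)⁻¹ }

/-- The braid group `B` of type `A₂` (braid group on three strands). -/
abbrev A2Group := PresentedGroup a2Relators

lemma a2_braid : sB * tB * sB = tB * sB * tB := by
  exact PresentedMonoid.mk_eq_mk_of_rel ⟨rfl, rfl⟩

lemma a2Gen_mul_not_mul (b : Bool) : a2Gen b * a2Gen (!b) * a2Gen b = w0B := by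
  cases b
  · exact a2_braid.symm
  · rfl

lemma w0B_mul_a2Gen (b : Bool) : w0B * a2Gen b = a2Gen (!b) * w0B := by
  nth_rewrite 1 [← a2Gen_mul_not_mul (!b)]
  rw [← a2Gen_mul_not_mul b, Bool.not_not]
  simp only [mul_assoc]

lemma w0B_mul_a2Gen_pow (b : Bool) (a : ℕ) : w0B * a2Gen b ^ a = a2Gen (!b) ^ a * w0B :=
  (show SemiconjBy w0B (a2Gen b) (a2Gen (!b)) from w0B_mul_a2Gen b).pow_right a

lemma w0B_mul_altPow (b : Bool) (L : List ℕ) : w0B * altPow b L = altPow (!b) L * w0B := by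
  induction L generalizing b with
  | nil => simp [altPow]
  | cons a L ih =>
    rw [altPow, altPow, ← mul_assoc, w0B_mul_a2Gen_pow, mul_assoc, ih, mul_assoc]

lemma w0B_pow_mul_a2Gen_pow (e : ℕ) (b : Bool) (a : ℕ) :
    w0B ^ e * a2Gen b ^ a = a2Gen (b ^^ e.bodd) ^ a * w0B ^ e := by
  induction e generalizing b with
  | zero => simp
  | succ e ih =>
    rw [pow_succ, mul_assoc, w0B_mul_a2Gen_pow, ← mul_assoc, ih, mul_assoc]
    cases b <;> simp

lemma altPow_append_singleton (b : Bool) (L : List ℕ) (a : ℕ) :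
    altPow b (L ++ [a]) = altPow b L * a2Gen (b ^^ L.length.bodd) ^ a := by
  induction L generalizing b with
  | nil => simp [altPow]
  | cons c L ih => cases b <;> simp [altPow, ih, mul_assoc]

lemma altPow_cons_one_cons (b : Bool) (p q : ℕ) (R : List ℕ) :
    altPow b ((p + 1) :: 1 :: (q + 1) :: R) = w0B * altPow (!b) (p :: q :: R) := by
  have h : a2Gen b * (a2Gen (!b) * a2Gen b) = w0B := by rw [← mul_assoc, a2Gen_mul_not_mul]
  simp only [altPow, Bool.not_not, pow_one]
  rw [pow_succ, pow_succ', ← mul_assoc w0B, w0B_mul_a2Gen_pow, Bool.not_not, ← h]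
  simp only [mul_assoc]

lemma exists_eq_altPow (w : A2Monoid) : ∃ L, w = altPow true L := by
  induction w using PresentedMonoid.inductionOn with
  | _ z =>
  induction z using FreeMonoid.inductionOn' with
  | one => exact ⟨[], rfl⟩
  | of_mul x z ih =>
    obtain ⟨L, hL⟩ := ih
    rw [map_mul, hL]
    cases x
    · exact ⟨0 :: 1 :: L, by simp [altPow]; rfl⟩
    · exact ⟨1 :: 0 :: L, by simp [altPow]; rfl⟩

section Existence

variable {G : Type*} [Group G] (ι : A2Monoid →* G)

lemma isConj_map_of_semiconj {x y z : A2Monoid} (h : z * x = y * z) : IsConj (ι x) (ι y) :=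
  isConj_iff.2 ⟨ι z, by rw [← map_mul, h, map_mul, mul_inv_cancel_right]⟩

lemma isConj_map_mul_comm (x y : A2Monoid) : IsConj (ι (x * y)) (ι (y * x)) :=
  isConj_map_of_semiconj ι (z := y) (mul_assoc _ _ _).symm

lemma isConj_not_start (e : ℕ) (b : Bool) (L : List ℕ) :
    IsConj (ι (w0B ^ e * altPow b L)) (ι (w0B ^ e * altPow (!b) L)) :=
  isConj_map_of_semiconj ι (z := w0B) (by
    rw [mul_assoc, ← w0B_mul_altPow, ← mul_assoc, ← mul_assoc, ← pow_succ, ← pow_succ'])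

lemma isConj_start (e : ℕ) (b c : Bool) (L : List ℕ) :
    IsConj (ι (w0B ^ e * altPow b L)) (ι (w0B ^ e * altPow c L)) := by
  rcases eq_or_ne b c with rfl | h
  · exact IsConj.refl _
  · rw [Bool.eq_not_of_ne h.symm]
    exact isConj_not_start ι e b L

/-- Moving the first syllable to the end, across the power of `w0B`. -/
lemma isConj_head (e : ℕ) (b : Bool) (a : ℕ) (L : List ℕ) :
    IsConj (ι (w0B ^ e * altPow b (a :: L)))
      (ι (w0B ^ e * (altPow (!b) L * a2Gen (b ^^ e.bodd) ^ a))) := by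
  rw [altPow, ← mul_assoc, w0B_pow_mul_a2Gen_pow, mul_assoc, ← mul_assoc (w0B ^ e)]
  exact isConj_map_mul_comm ι _ _

lemma isConj_rotate {e : ℕ} (L : List ℕ) (h : (e + L.length).bodd = false) (b c : Bool) (k : ℕ) :
    IsConj (ι (w0B ^ e * altPow b L)) (ι (w0B ^ e * altPow c (L.rotate k))) := by
  induction k generalizing L b with
  | zero => simpa using isConj_start ι e b c L
  | succ k ih =>
    cases L with
    | nil => simpa using isConj_start ι e b c []
    | cons a L =>
      refine (isConj_head ι e b a L).trans ?_
      rw [List.rotate_cons_succ]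
      refine IsConj.trans ?_ (ih (L ++ [a]) (by simpa using h) (!b))
      have : (b ^^ e.bodd) = (!b ^^ L.length.bodd) := by
        revert h
        simp only [List.length_cons, Nat.bodd_add, Nat.bodd_succ]
        cases b <;> cases e.bodd <;> cases L.length.bodd <;> decide
      rw [altPow_append_singleton, this]

lemma isConj_isRotated {e : ℕ} {L L' : List ℕ} (h : (e + L.length).bodd = false) (b c : Bool)
    (hL : L ~r L') : IsConj (ι (w0B ^ e * altPow b L)) (ι (w0B ^ e * altPow c L')) := by
  obtain ⟨k, rfl⟩ := hL
  exact isConj_rotate ι L h b c k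

/-- `x` is conjugate to a power of `piB` times a canonical representative. -/
def HasShape (x : A2Monoid) : Prop :=
  ∃ (n : ℕ) (y : A2Monoid), Shape y ∧ IsConj (ι x) (ι (piB ^ n * y))

variable {ι}

lemma HasShape.of_isConj {x y : A2Monoid} (hy : HasShape ι y) (h : IsConj (ι x) (ι y)) :
    HasShape ι x := by
  obtain ⟨n, z, hz, hc⟩ := hy
  exact ⟨n, z, hz, h.trans hc⟩

lemma hasShape_even {e : ℕ} (he : e.bodd = false) {y : A2Monoid} (hy : Shape y) :
    HasShape ι (w0B ^ e * y) := by
  refine ⟨e.div2, y, hy, ?_⟩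
  have h : w0B ^ e = piB ^ e.div2 := by
    conv_lhs => rw [← Nat.bodd_add_div2 e, he]
    rw [piB, ← pow_two, ← pow_mul]
    simp
  rw [h]

lemma hasShape_odd {e : ℕ} (he : e.bodd = true) {y : A2Monoid} (hy : Shape (w0B * y)) :
    HasShape ι (w0B ^ e * y) := by
  obtain ⟨e, rfl⟩ : ∃ f, e = f + 1 := ⟨e - 1, by cases e <;> simp_all⟩
  rw [pow_succ, mul_assoc]
  exact hasShape_even (by simpa using he) hy

lemma exists_isRotated_cyclicallyMaximal (L : List ℕ) : ∃ L', L ~r L' ∧ CyclicallyMaximal L' := by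
  obtain ⟨k, -, hk⟩ := Finset.exists_max_image (Finset.range (L.length + 1)) (fun k => L.rotate k)
    ⟨0, by simp⟩
  refine ⟨L.rotate k, ⟨k, rfl⟩, fun d hd => ?_⟩
  rw [List.rotate_rotate, ← List.rotate_mod L (k + d)] at hd
  refine absurd hd (not_lt.2 (hk _ ?_))
  rcases Nat.eq_zero_or_pos L.length with h | h
  · simp [List.length_eq_zero_iff.1 h] at hd
  · have := Nat.mod_lt (k + d) h
    simp only [Finset.mem_range]
    lia

lemma hasShape_of_two_le {e : ℕ} {L : List ℕ} (b : Bool) (h : (e + L.length).bodd = false)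
    (h2 : ∀ a ∈ L, 2 ≤ a) : HasShape ι (w0B ^ e * altPow b L) := by
  obtain ⟨L', hr, hm⟩ := exists_isRotated_cyclicallyMaximal L
  refine HasShape.of_isConj ?_ (isConj_isRotated ι h b true hr)
  have h2' : ∀ a ∈ L', 2 ≤ a := fun a ha => h2 a (hr.mem_iff.2 ha)
  rw [hr.perm.length_eq, Nat.bodd_add] at h
  have hdiv := Nat.bodd_add_div2 L'.length
  rcases he : e.bodd with _ | _
  · refine hasShape_even he ?_
    rcases L'.eq_nil_or_concat' with rfl | ⟨l, a, hl⟩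
    · exact Or.inl ⟨0, by simp [altPow]⟩
    · simp [he] at h
      have : 0 < L'.length := by simp [hl]
      simp only [h, Bool.toNat_false, zero_add] at hdiv
      exact Or.inr (Or.inr (Or.inl ⟨L'.length.div2, L', by lia, hdiv.symm, h2', hm, rfl⟩))
  · refine hasShape_odd he ?_
    simp [he] at h
    simp only [h, Bool.toNat_true] at hdiv
    exact Or.inr (Or.inr (Or.inr (Or.inr
      ⟨L'.length.div2 + 1, L', by lia, by lia, h2', hm, rfl⟩)))

theorem hasShape_w0B_pow_mul_altPow (L : List ℕ) (e : ℕ) (b : Bool) :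
    HasShape ι (w0B ^ e * altPow b L) := by
  induction hn : L.length using Nat.strong_induction_on generalizing L e b with
  | _ n ih =>
  subst hn
  rcases hpar : (e + L.length).bodd with _ | _
  · by_cases h0 : 0 ∈ L
    · obtain ⟨l₁, l₂, rfl⟩ := List.append_of_mem h0
      refine HasShape.of_isConj ?_
        (isConj_isRotated ι hpar b true (List.isRotated_append (l := l₁) (l' := 0 :: l₂)))
      have : altPow true (0 :: l₂ ++ l₁) = altPow false (l₂ ++ l₁) := by simp [altPow]
      rw [this]
      exact ih _ (by simp; lia) _ _ _ rfl
    by_cases h1 : 1 ∈ L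
    · obtain ⟨l₁, l₂, rfl⟩ := List.append_of_mem h1
      have hr : l₁ ++ 1 :: l₂ ~r 1 :: (l₂ ++ l₁) := List.isRotated_append
      obtain ⟨l, hl⟩ : ∃ l, l = l₂ ++ l₁ := ⟨_, rfl⟩
      rw [← hl] at hr
      rcases l.eq_nil_or_concat' with rfl | ⟨l', p, rfl⟩
      · refine HasShape.of_isConj ?_ (isConj_isRotated ι hpar b true hr)
        rw [hr.perm.length_eq] at hpar
        refine hasShape_odd (by simpa using hpar) (Or.inr (Or.inr (Or.inr (Or.inl ⟨1, le_rfl, ?_⟩))))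
        simp [altPow, sB]
      · have hr' : l₁ ++ 1 :: l₂ ~r p :: 1 :: l' := by
          refine hr.trans ?_
          rw [← List.cons_append]
          exact List.isRotated_append
        have hp : p ≠ 0 := by
          rintro rfl
          exact h0 (hr'.mem_iff.2 (by simp))
        obtain ⟨p, rfl⟩ := Nat.exists_eq_succ_of_ne_zero hp
        refine HasShape.of_isConj ?_ (isConj_isRotated ι hpar b true hr')
        have hlen := hr'.perm.length_eq
        rw [hlen] at hpar ih
        rcases l' with _ | ⟨q, R⟩
        · rcases p with _ | p
          · refine hasShape_even (by simpa using hpar) (Or.inr (Or.inl ?_))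
            simp [altPow, sB, tB]
          · have he : e.bodd = false := by simpa using hpar
            have hc := isConj_map_mul_comm ι sB (w0B ^ e * altPow true [p + 1, 1])
            have h₁ : sB * (w0B ^ e * altPow true [p + 1, 1]) =
                w0B ^ e * altPow true [p + 2, 1] := by
              have := w0B_pow_mul_a2Gen_pow e true 1
              simp only [he, pow_one, Bool.xor_false] at this
              rw [← mul_assoc, sB, ← this]
              simp [altPow, pow_succ', mul_assoc]
            have h₂ : w0B ^ e * altPow true [p + 1, 1] * sB = w0B ^ (e + 1) * altPow false [p] := by
              have h₃ := altPow_cons_one_cons true p 0 []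
              have h₄ : altPow true [p + 1, 1, 0 + 1] = altPow true [p + 1, 1] * sB := by
                simp [altPow, sB, mul_assoc]
              have h₅ : altPow false [p, 0] = altPow false [p] := by simp [altPow]
              rw [mul_assoc, ← h₄, h₃, Bool.not_true, h₅, pow_succ, mul_assoc]
            rw [h₁, h₂] at hc
            exact (ih 1 (by simp) [p] _ _ rfl).of_isConj hc
        · have hq : q ≠ 0 := by
            rintro rfl
            exact h0 (hr'.mem_iff.2 (by simp))
          obtain ⟨q, rfl⟩ := Nat.exists_eq_succ_of_ne_zero hq
          rw [Nat.succ_eq_add_one, Nat.succ_eq_add_one, altPow_cons_one_cons, ← mul_assoc,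
            ← pow_succ]
          exact ih _ (by simp) _ _ _ rfl
    · refine hasShape_of_two_le b hpar fun a ha => ?_
      rcases a with _ | _ | a
      · exact absurd ha h0
      · exact absurd ha h1
      · lia
  · rcases L with _ | ⟨a, L⟩
    · refine hasShape_odd (by simpa using hpar) (Or.inr (Or.inr (Or.inr (Or.inl ⟨0, by simp, ?_⟩))))
      simp [altPow]
    rcases L.eq_nil_or_concat' with rfl | ⟨l, z, rfl⟩
    · refine HasShape.of_isConj ?_ (isConj_start ι e b true _)
      refine hasShape_even (by simpa using hpar) (Or.inl ⟨a, ?_⟩)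
      simp [altPow, sB]
    · refine HasShape.of_isConj ?_ (isConj_head ι e b a _)
      have : (b ^^ e.bodd) = (!b ^^ l.length.bodd) := by
        revert hpar
        simp only [List.length_cons, List.length_append, List.length_nil, Nat.bodd_add,
          Nat.bodd_succ]
        cases b <;> cases e.bodd <;> cases l.length.bodd <;> decide
      rw [altPow_append_singleton, this, mul_assoc, ← pow_add, ← altPow_append_singleton]
      exact ih _ (by simp) _ _ _ rfl

variable (ι) in
theorem hasShape (w : A2Monoid) : HasShape ι w := by
  obtain ⟨L, rfl⟩ := exists_eq_altPow w
  simpa using hasShape_w0B_pow_mul_altPow (ι := ι) L 0 true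

end Existence

section ModularGroup

open Matrix

/-- The image of the generator `𝐬` in `SL(2, ℤ)`. -/
def matS : Matrix.SpecialLinearGroup (Fin 2) ℤ := ⟨!![1, 1; 0, 1], by decide⟩

/-- The image of the generator `𝐭` in `SL(2, ℤ)`. -/
def matT : Matrix.SpecialLinearGroup (Fin 2) ℤ := ⟨!![1, 0; -1, 1], by decide⟩

/-- The transpose of `matS`; together they freely generate the nonnegative matrices. -/
def matC : Matrix.SpecialLinearGroup (Fin 2) ℤ := ⟨!![1, 0; 1, 1], by decide⟩

/-- The image of `w0B` in `SL(2, ℤ)`. -/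
def matX : Matrix.SpecialLinearGroup (Fin 2) ℤ := ⟨!![0, 1; -1, 0], by decide⟩

/-- The image of `𝐬𝐭` in `SL(2, ℤ)`. -/
def matU : Matrix.SpecialLinearGroup (Fin 2) ℤ := ⟨!![0, 1; -1, 1], by decide⟩

/-- The product of the matrices `matS` (for `true`) and `matC` (for `false`) along a word. -/
def word (V : List Bool) : Matrix.SpecialLinearGroup (Fin 2) ℤ :=
  (V.map fun b => bif b then matS else matC).prod

lemma word_nil : word [] = 1 := rfl

lemma word_true_cons (V : List Bool) : word (true :: V) = matS * word V := by simp [word]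

lemma word_false_cons (V : List Bool) : word (false :: V) = matC * word V := by simp [word]

lemma word_append (V W : List Bool) : word (V ++ W) = word V * word W := by simp [word]

lemma word_replicate_true (a : ℕ) : word (List.replicate a true) = matS ^ a := by simp [word]

lemma mul_apply_fin_two (A B : Matrix.SpecialLinearGroup (Fin 2) ℤ) (i j : Fin 2) :
    (A * B) i j = A i 0 * B 0 j + A i 1 * B 1 j := by
  rw [Matrix.SpecialLinearGroup.coe_mul, Matrix.mul_apply, Fin.sum_univ_two]

lemma matS_mul_apply (A : Matrix.SpecialLinearGroup (Fin 2) ℤ) (j : Fin 2) :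
    (matS * A) 0 j = A 0 j + A 1 j ∧ (matS * A) 1 j = A 1 j := by
  rw [mul_apply_fin_two, mul_apply_fin_two, show matS 0 0 = 1 from rfl, show matS 0 1 = 1 from rfl,
    show matS 1 0 = 0 from rfl, show matS 1 1 = 1 from rfl]
  simp

lemma matC_mul_apply (A : Matrix.SpecialLinearGroup (Fin 2) ℤ) (j : Fin 2) :
    (matC * A) 0 j = A 0 j ∧ (matC * A) 1 j = A 0 j + A 1 j := by
  rw [mul_apply_fin_two, mul_apply_fin_two, show matC 0 0 = 1 from rfl, show matC 0 1 = 0 from rfl,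
    show matC 1 0 = 1 from rfl, show matC 1 1 = 1 from rfl]
  simp

lemma matX_mul_apply (A : Matrix.SpecialLinearGroup (Fin 2) ℤ) (j : Fin 2) :
    (matX * A) 0 j = A 1 j ∧ (matX * A) 1 j = -A 0 j := by
  rw [mul_apply_fin_two, mul_apply_fin_two, show matX 0 0 = 0 from rfl, show matX 0 1 = 1 from rfl,
    show matX 1 0 = -1 from rfl, show matX 1 1 = 0 from rfl]
  simp

lemma word_entries (V : List Bool) :
    1 ≤ word V 0 0 ∧ 0 ≤ word V 0 1 ∧ 0 ≤ word V 1 0 ∧ 1 ≤ word V 1 1 := by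
  induction V with
  | nil => simp [word_nil]
  | cons b V ih =>
    cases b
    · rw [word_false_cons, (matC_mul_apply _ _).1, (matC_mul_apply _ _).1, (matC_mul_apply _ _).2,
        (matC_mul_apply _ _).2]
      lia
    · rw [word_true_cons, (matS_mul_apply _ _).1, (matS_mul_apply _ _).1, (matS_mul_apply _ _).2,
        (matS_mul_apply _ _).2]
      lia

lemma word_off_diagonal {V : List Bool} (hV : V ≠ []) : 1 ≤ word V 0 1 + word V 1 0 := by
  rcases V with _ | ⟨b, V⟩
  · exact absurd rfl hV
  · have := word_entries V
    cases b
    · rw [word_false_cons, (matC_mul_apply _ _).1, (matC_mul_apply _ _).2]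
      lia
    · rw [word_true_cons, (matS_mul_apply _ _).1, (matS_mul_apply _ _).2]
      lia

lemma word_injective : Function.Injective word := by
  intro V
  induction V with
  | nil =>
    intro W h
    by_contra hW
    have := word_off_diagonal (V := W) (fun h' => hW h'.symm)
    rw [← h] at this
    simp [word_nil] at this
  | cons b V ih =>
    intro W h
    rcases W with _ | ⟨c, W⟩
    · have := word_off_diagonal (V := b :: V) (by simp)
      rw [h] at this
      simp [word_nil] at this
    · have hne : ∀ V W, word (true :: V) ≠ word (false :: W) := by
        intro V W h
        have hV := word_entries V
        have hW := word_entries W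
        rw [word_true_cons, word_false_cons] at h
        have h0 := congrArg (fun A : Matrix.SpecialLinearGroup (Fin 2) ℤ => A 0 0) h
        have h1 := congrArg (fun A : Matrix.SpecialLinearGroup (Fin 2) ℤ => A 1 0) h
        simp only [(matS_mul_apply _ _).1, (matC_mul_apply _ _).1, (matS_mul_apply _ _).2,
          (matC_mul_apply _ _).2] at h0 h1
        lia
      cases b <;> cases c
      · rw [word_false_cons, word_false_cons, mul_left_cancel_iff] at h
        rw [ih h]
      · exact absurd h.symm (hne _ _)
      · exact absurd h (hne _ _)
      · rw [word_true_cons, word_true_cons, mul_left_cancel_iff] at h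
        rw [ih h]

/-- The projection `SL(2, ℤ) → PSL(2, ℤ)`. -/
def toPSL : Matrix.SpecialLinearGroup (Fin 2) ℤ →* ProjectiveSpecialLinearGroup (Fin 2) ℤ :=
  QuotientGroup.mk' _

lemma toPSL_eq_iff {A B : Matrix.SpecialLinearGroup (Fin 2) ℤ} :
    toPSL A = toPSL B ↔ B = A ∨ B = -A := by
  rw [toPSL, QuotientGroup.mk'_eq_mk']
  constructor
  · rintro ⟨z, hz, rfl⟩
    obtain ⟨r, hr, h⟩ := Matrix.SpecialLinearGroup.mem_center_iff.1 hz
    rw [Fintype.card_fin, sq_eq_one_iff] at hr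
    rcases hr with rfl | rfl
    · left
      rw [show z = 1 from Subtype.ext (by rw [← h]; simp), mul_one]
    · right
      rw [show z = -1 from Subtype.ext (by rw [← h]; simp), mul_neg_one]
  · rintro (rfl | rfl)
    · exact ⟨1, one_mem _, mul_one _⟩
    · exact ⟨-1, Matrix.SpecialLinearGroup.mem_center_iff.2 ⟨-1, by norm_num, by simp⟩, mul_neg_one A⟩

lemma toPSL_neg (A : Matrix.SpecialLinearGroup (Fin 2) ℤ) : toPSL (-A) = toPSL A :=
  toPSL_eq_iff.2 (Or.inr (neg_neg A).symm)

lemma toPSL_word_injective : Function.Injective fun V => toPSL (word V) := by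
  intro V W h
  rcases toPSL_eq_iff.1 h with h | h
  · exact word_injective h.symm
  · have hV := word_entries V
    have hW := word_entries W
    rw [h] at hW
    simp only [Matrix.SpecialLinearGroup.coe_neg, Matrix.neg_apply] at hW
    lia

lemma toPSL_matX_sq : toPSL matX * toPSL matX = 1 := by
  rw [← map_mul, ← map_one toPSL, ← toPSL_neg 1]
  exact congrArg toPSL (by decide)

lemma toPSL_matX_pow (e : ℕ) : toPSL matX ^ e = toPSL matX ^ e.bodd.toNat := by
  conv_lhs => rw [← Nat.bodd_add_div2 e, pow_add, pow_mul, pow_two, toPSL_matX_sq, one_pow, mul_one]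

/-- Left multiplication by `h` only affects a bounded initial part of a word. -/
def AltersPrefix (h : Matrix.SpecialLinearGroup (Fin 2) ℤ) : Prop :=
  ∃ N : ℕ, ∀ (e : Bool) (V : List Bool), N ≤ V.length → ∃ (e' : Bool) (V' : List Bool),
    V.length ≤ V'.length + N ∧
      toPSL (h * (matX ^ e.toNat * word V)) = toPSL (matX ^ e'.toNat * word V')

lemma AltersPrefix.mul {g h : Matrix.SpecialLinearGroup (Fin 2) ℤ} (hg : AltersPrefix g)
    (hh : AltersPrefix h) : AltersPrefix (g * h) := by
  obtain ⟨N, hN⟩ := hg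
  obtain ⟨M, hM⟩ := hh
  refine ⟨N + M, fun e V hV => ?_⟩
  obtain ⟨e', V', hV', h'⟩ := hM e V (by lia)
  obtain ⟨e'', V'', hV'', h''⟩ := hN e' V' (by lia)
  refine ⟨e'', V'', by lia, ?_⟩
  rw [mul_assoc, map_mul, h', ← map_mul, h'']

lemma altersPrefix_one : AltersPrefix 1 := ⟨0, fun e V _ => ⟨e, V, by simp, by simp⟩⟩

lemma altersPrefix_matX : AltersPrefix matX := by
  refine ⟨0, fun e V _ => ?_⟩
  cases e
  · exact ⟨true, V, by simp, by simp⟩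
  · refine ⟨false, V, by simp, ?_⟩
    simp [← mul_assoc, toPSL_matX_sq]

lemma altersPrefix_matU : AltersPrefix matU := by
  refine ⟨1, fun e V hV => ?_⟩
  cases e
  · rcases V with _ | ⟨b, V⟩
    · simp at hV
    · cases b
      · refine ⟨false, true :: V, by simp, congrArg toPSL ?_⟩
        rw [word_false_cons, word_true_cons, show matS = matU * matC by decide]
        simp [mul_assoc]
      · refine ⟨true, V, by simp, congrArg toPSL ?_⟩
        rw [word_true_cons, show matX = matU * matS by decide]
        simp [mul_assoc]
  · refine ⟨false, false :: V, by simp; lia, ?_⟩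
    rw [word_false_cons, show matC = -(matU * matX) by decide]
    simp [mul_assoc, toPSL_neg]

lemma altersPrefix (h : Matrix.SpecialLinearGroup (Fin 2) ℤ) : AltersPrefix h := by
  have hh : h ∈ Subgroup.closure {ModularGroup.S, ModularGroup.T} := by
    simp [SpecialLinearGroup.SL2Z_generators]
  have hX := altersPrefix_matX
  have hU := altersPrefix_matU
  induction hh using Subgroup.closure_induction'' with
  | one => exact altersPrefix_one
  | mul x y _ _ hx hy => exact hx.mul hy
  | mem x hx =>
    rcases hx with rfl | rfl
    · rw [show ModularGroup.S = matX * matX * matX by decide]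
      exact (hX.mul hX).mul hX
    · rw [show ModularGroup.T = matU * matU * matX * matX * matX by decide]
      exact (((hU.mul hU).mul hX).mul hX).mul hX
  | inv_mem x hx =>
    rcases hx with rfl | rfl
    · rwa [show ModularGroup.S⁻¹ = matX by decide]
    · rw [show ModularGroup.T⁻¹ = matX * matX * matX * matU by decide]
      exact ((hX.mul hX).mul hX).mul hU

lemma sum_entries_lt {a b c d e f g h p q r s α β γ δ : ℤ} (ha : 1 ≤ a) (hb : 0 ≤ b) (hc : 0 ≤ c)
    (hd : 1 ≤ d) (he : 1 ≤ e) (hf : 0 ≤ f) (hg : 0 ≤ g) (hh : 1 ≤ h) (hfg : 1 ≤ f + g)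
    (hp : 1 ≤ p) (hq : 0 ≤ q) (hr : 0 ≤ r) (hs : 1 ≤ s) (hα : α = a * e + b * g)
    (hβ : β = a * f + b * h) (hγ : γ = c * e + d * g) (hδ : δ = c * f + d * h) :
    a + b + c + d < (p + q) * (α + β) + (r + s) * (γ + δ) := by
  have h₁ : a + b + f ≤ α + β := by
    subst hα hβ
    nlinarith [mul_nonneg hb hg, mul_nonneg (sub_nonneg.2 ha) hf,
      mul_nonneg hb (sub_nonneg.2 hh), mul_nonneg (sub_nonneg.2 ha) (sub_nonneg.2 he)]
  have h₂ : c + d + g ≤ γ + δ := by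
    subst hγ hδ
    nlinarith [mul_nonneg hc hf, mul_nonneg (sub_nonneg.2 hd) hg,
      mul_nonneg hc (sub_nonneg.2 he), mul_nonneg (sub_nonneg.2 hd) (sub_nonneg.2 hh)]
  nlinarith [mul_nonneg (by lia : 0 ≤ p + q - 1) (by lia : 0 ≤ α + β),
    mul_nonneg (by lia : 0 ≤ r + s - 1) (by lia : 0 ≤ γ + δ)]

lemma not_toPSL_matX_mul_word_eq {A B M : List Bool} (hB : B ≠ []) :
    toPSL (matX * word A * word B) ≠ toPSL (word M * (matX * word A)) := by
  intro h
  have hA' := word_entries A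
  have hM' := word_entries M
  have hB' := word_entries B
  have hB'' := word_off_diagonal hB
  have hdet := Matrix.SpecialLinearGroup.det_coe (word M)
  rw [det_fin_two] at hdet
  have key : ∀ ε : ℤ, ε = 1 ∨ ε = -1 → (∀ i j, (word M * (matX * word A)) i j =
      ε * (matX * word A * word B) i j) → False := by
    intro ε hε hent
    have h₀₀ := hent 0 0
    have h₀₁ := hent 0 1
    have h₁₀ := hent 1 0
    have h₁₁ := hent 1 1
    simp only [mul_apply_fin_two (word M), mul_apply_fin_two _ (word B), (matX_mul_apply _ _).1,
      (matX_mul_apply _ _).2] at h₀₀ h₀₁ h₁₀ h₁₁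
    generalize word M 0 0 = p, word M 0 1 = q, word M 1 0 = r, word M 1 1 = s,
      word A 0 0 = a, word A 0 1 = b, word A 1 0 = c, word A 1 1 = d,
      word B 0 0 = e, word B 0 1 = f, word B 1 0 = g, word B 1 1 = h at *
    obtain ⟨ha, hb, hc, hd⟩ := hA'
    obtain ⟨he, hf, hg, hh⟩ := hB'
    obtain ⟨hp, hq, hr, hs⟩ := hM'
    have hlt := sum_entries_lt ha hb hc hd he hf hg hh hB'' hp hq hr hs rfl rfl rfl rfl
    have hsum : a + b + c + d = ε * ((p + q) * (a * e + b * g + (a * f + b * h)) +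
        (r + s) * (c * e + d * g + (c * f + d * h))) := by
      linear_combination (-a - b - c - d) * hdet + (r + s) * (h₀₀ + h₀₁) - (p + q) * (h₁₀ + h₁₁)
    rcases hε with rfl | rfl <;> linarith
  rcases toPSL_eq_iff.1 h with h | h
  · exact key 1 (Or.inl rfl) fun i j => by rw [h, one_mul]
  · exact key (-1) (Or.inr rfl) fun i j => by rw [h]; simp

/-- Words that are conjugate in `PSL(2, ℤ)` are conjugate in the free monoid. -/
theorem exists_append_eq_append_of_isConj {W W' : List Bool}
    (h : IsConj (toPSL (word W)) (toPSL (word W'))) : ∃ V, V ++ W = W' ++ V := by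
  obtain ⟨c, hc⟩ := isConj_iff.1 h
  obtain ⟨g, rfl⟩ : ∃ g, toPSL g = c := QuotientGroup.mk'_surjective _ c
  rcases eq_or_ne W [] with rfl | hW
  · have : toPSL (word []) = toPSL (word W') := by
      rw [← hc]
      simp [word_nil]
    exact ⟨[], by simpa using toPSL_word_injective this⟩
  obtain ⟨N, hN⟩ := altersPrefix g
  have hpow : ∀ n, ∃ W₁ : List Bool, n ≤ W₁.length ∧ Commute (word W₁) (word W) := by
    intro n
    induction n with
    | zero => exact ⟨[], by simp, Commute.one_left _⟩
    | succ n ih =>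
      obtain ⟨W₁, h₁, h₂⟩ := ih
      refine ⟨W ++ W₁, ?_, ?_⟩
      · have := List.length_pos_iff.2 hW
        simp
        lia
      · rw [word_append]
        exact (Commute.refl _).mul_left h₂
  obtain ⟨W₁, hlen, hcomm⟩ := hpow N
  obtain ⟨e, V, -, hV⟩ := hN false W₁ hlen
  have hconj : toPSL (matX ^ e.toNat * word V * word W) =
      toPSL (word W' * (matX ^ e.toNat * word V)) := by
    rw [map_mul, map_mul toPSL (word W'), ← hV, ← hc]
    simp only [map_mul, Bool.toNat_false, pow_zero, one_mul]
    rw [mul_assoc, ← map_mul toPSL (word W₁), hcomm.eq, map_mul]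
    group
  cases e
  · refine ⟨V, toPSL_word_injective ?_⟩
    simpa [word_append] using hconj
  · exact absurd (by simpa using hconj) (not_toPSL_matX_mul_word_eq (A := V) (M := W') hW)

lemma abs_trace_eq_of_isConj {A B : Matrix.SpecialLinearGroup (Fin 2) ℤ}
    (h : IsConj (toPSL A) (toPSL B)) :
    |(A : Matrix (Fin 2) (Fin 2) ℤ).trace| = |(B : Matrix (Fin 2) (Fin 2) ℤ).trace| := by
  obtain ⟨c, hc⟩ := isConj_iff.1 h
  obtain ⟨g, rfl⟩ : ∃ g, toPSL g = c := QuotientGroup.mk'_surjective _ c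
  have htr : ((g * A * g⁻¹ : Matrix.SpecialLinearGroup (Fin 2) ℤ) : Matrix (Fin 2) (Fin 2) ℤ).trace =
      (A : Matrix (Fin 2) (Fin 2) ℤ).trace := by
    rw [Matrix.SpecialLinearGroup.coe_mul, trace_mul_comm, ← Matrix.SpecialLinearGroup.coe_mul]
    simp
  rw [← map_inv, ← map_mul, ← map_mul] at hc
  rcases toPSL_eq_iff.1 hc with h | h
  · rw [h, htr]
  · rw [h, Matrix.SpecialLinearGroup.coe_neg, trace_neg, htr, abs_neg]

lemma two_le_abs_trace_word (V : List Bool) :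
    2 ≤ |(word V : Matrix (Fin 2) (Fin 2) ℤ).trace| := by
  have := word_entries V
  rw [trace_fin_two]
  exact le_trans (by lia) (le_abs_self _)

end ModularGroup

section CyclicWords

lemma isRotated_of_append_eq_append {α : Type*} {V W W' : List α} (h : V ++ W = W' ++ V) :
    W ~r W' := by
  induction hn : V.length using Nat.strong_induction_on generalizing V with
  | _ n ih =>
  subst hn
  rcases List.append_eq_append_iff.1 h with ⟨Z, rfl, rfl⟩ | ⟨Z, hV, hZ⟩
  · exact List.isRotated_append
  · rcases eq_or_ne W' [] with rfl | hW'
    · simp only [List.nil_append] at h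
      rw [List.append_right_eq_self.1 h]
    · refine ih Z.length ?_ (V := Z) ?_ rfl
      · rw [hV, List.length_append]
        have := List.length_pos_iff.2 hW'
        lia
      · rw [← hZ, hV]

lemma CyclicallyMaximal.eq_of_isRotated {L L' : List ℕ} (hL : CyclicallyMaximal L)
    (hL' : CyclicallyMaximal L') (h : L ~r L') : L = L' := by
  obtain ⟨d, hd⟩ := h.symm
  obtain ⟨d', hd'⟩ := h
  have h₁ : ¬ L < L' := by
    have := hL d'
    rwa [hd'] at this
  have h₂ : ¬ L' < L := by
    have := hL' d
    rwa [hd] at this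
  exact le_antisymm (not_lt.1 h₂) (not_lt.1 h₁)

/-- The word encoding a sequence of integers at least `2`: an entry `a` becomes `a - 2` times
`true` followed by one `false`. -/
def code : List ℕ → List Bool
  | [] => []
  | a :: L => List.replicate (a - 2) true ++ false :: code L

lemma code_append (K L : List ℕ) : code (K ++ L) = code K ++ code L := by
  induction K with
  | nil => rfl
  | cons a K ih => simp [code, ih]

lemma count_false_code (L : List ℕ) : (code L).count false = L.length := by
  induction L with
  | nil => rfl
  | cons a L ih => simp [code, ih, List.count_replicate]

lemma exists_code_eq_append {L : List ℕ} (hL : L ≠ []) : ∃ V, code L = V ++ [false] := by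
  rcases L.eq_nil_or_concat' with rfl | ⟨K, a, rfl⟩
  · exact absurd rfl hL
  · exact ⟨code K ++ List.replicate (a - 2) true, by simp [code_append, code]⟩

lemma replicate_append_false_cons_inj {a b : ℕ} {V W : List Bool}
    (h : List.replicate a true ++ false :: V = List.replicate b true ++ false :: W) :
    a = b ∧ V = W := by
  induction a generalizing b with
  | zero => cases b <;> simp_all [List.replicate_succ]
  | succ a ih =>
    cases b with
    | zero => simp [List.replicate_succ] at h
    | succ b =>
      simp only [List.replicate_succ, List.cons_append, List.cons.injEq, true_and] at h
      simpa using ih h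

lemma eq_of_code_eq_code {K L : List ℕ} (hK : ∀ a ∈ K, 2 ≤ a) (hL : ∀ a ∈ L, 2 ≤ a)
    (h : code K = code L) : K = L := by
  induction K generalizing L with
  | nil => cases L <;> simp_all [code]
  | cons a K ih =>
    rcases L with _ | ⟨b, L⟩
    · simp [code] at h
    · obtain ⟨h₁, h₂⟩ := replicate_append_false_cons_inj h
      have ha := hK a (by simp)
      have hb := hL b (by simp)
      rw [ih (fun c hc => hK c (by simp [hc])) (fun c hc => hL c (by simp [hc])) h₂,
        show a = b by lia]

lemma exists_eq_code_append (V : List Bool) : ∃ (K : List ℕ) (r : ℕ),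
    (∀ a ∈ K, 2 ≤ a) ∧ V = code K ++ List.replicate r true := by
  induction V with
  | nil => exact ⟨[], 0, by simp, rfl⟩
  | cons b V ih =>
    obtain ⟨K, r, hK, rfl⟩ := ih
    cases b
    · exact ⟨2 :: K, r, by simpa using hK, rfl⟩
    · rcases K with _ | ⟨k, K⟩
      · exact ⟨[], r + 1, by simp, rfl⟩
      · have hk := hK k (by simp)
        refine ⟨(k + 1) :: K, r, ?_, ?_⟩
        · simp only [List.mem_cons, forall_eq_or_imp] at hK ⊢
          exact ⟨by lia, hK.2⟩
        · rw [code, code, show k + 1 - 2 = k - 2 + 1 by lia]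
          rfl

lemma isRotated_of_code {L L' : List ℕ} (hL : ∀ a ∈ L, 2 ≤ a) (hL' : ∀ a ∈ L', 2 ≤ a)
    (h0 : L ≠ []) {V : List Bool} (h : V ++ code L = code L' ++ V) : L ~r L' := by
  obtain ⟨K, r, hK, rfl⟩ := exists_eq_code_append V
  rcases r with _ | r
  · simp only [List.replicate_zero, List.append_nil, ← code_append] at h
    refine isRotated_of_append_eq_append (V := K) (eq_of_code_eq_code ?_ ?_ h)
    · simp only [List.mem_append]
      rintro a (ha | ha)
      exacts [hK a ha, hL a ha]
    · simp only [List.mem_append]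
      rintro a (ha | ha)
      exacts [hL' a ha, hK a ha]
  · obtain ⟨W, hW⟩ := exists_code_eq_append h0
    have := congrArg List.getLast? h
    rw [hW, List.replicate_succ', ← List.append_assoc, ← List.append_assoc, ← List.append_assoc,
      List.getLast?_append, List.getLast?_append] at this
    simp at this

/-- The word attached to a representative of infinite order: `L` records the exponents in the
families (iii) and (v), and `a` the exponent in the family (i). -/
def codeWord (L : List ℕ) (a : ℕ) : List Bool := code L ++ List.replicate a true

lemma eq_of_codeWord {L L' : List ℕ} {a a' : ℕ} (h0 : L = [] ∨ a = 0) (h0' : L' = [] ∨ a' = 0)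
    (h2 : ∀ a ∈ L, 2 ≤ a) (h2' : ∀ a ∈ L', 2 ≤ a) (hm : CyclicallyMaximal L)
    (hm' : CyclicallyMaximal L') {V : List Bool} (h : V ++ codeWord L a = codeWord L' a' ++ V) :
    L = L' ∧ a = a' := by
  have hcount := congrArg (List.count false) h
  have hlen := congrArg List.length h
  simp only [codeWord, List.count_append, count_false_code, List.count_replicate,
    List.length_append, List.length_replicate] at hcount hlen
  have hLL : L.length = L'.length := by simpa [add_comm] using hcount
  rcases eq_or_ne L [] with rfl | hne
  · obtain rfl : L' = [] := List.length_eq_zero_iff.1 hLL.symm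
    exact ⟨rfl, by simpa [code, add_comm] using hlen⟩
  · have hne' : L' ≠ [] := by
      rw [← List.length_pos_iff, ← hLL]
      exact List.length_pos_iff.2 hne
    obtain rfl := h0.resolve_left hne
    obtain rfl := h0'.resolve_left hne'
    simp only [codeWord, List.replicate_zero, List.append_nil] at h
    exact ⟨hm.eq_of_isRotated hm' (isRotated_of_code h2 h2' hne h), rfl⟩

end CyclicWords

section Uniqueness

/-- The representative in the families (i), (iii), (v) with the given exponents. -/
def loxRep (L : List ℕ) (a : ℕ) : A2Monoid :=
  if L = [] then sB ^ a else if L.length.bodd then w0B * altPow true L else altPow true L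

lemma Shape.cases {y : A2Monoid} (hy : Shape y) : y = sB * tB ∨ y = w0B ∨ y = w0B * sB ∨
    ∃ L a, (L = [] ∨ a = 0) ∧ (∀ b ∈ L, 2 ≤ b) ∧ CyclicallyMaximal L ∧ y = loxRep L a := by
  rcases hy with ⟨a, rfl⟩ | rfl | ⟨k, L, hk, hlen, h2, hm, rfl⟩ | ⟨a, ha, rfl⟩ |
    ⟨k, L, hk, hlen, h2, hm, rfl⟩
  · exact Or.inr (Or.inr (Or.inr ⟨[], a, Or.inl rfl, by simp,
      fun d => by simp, by simp [loxRep]⟩))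
  · exact Or.inl rfl
  · have : L ≠ [] := List.length_pos_iff.1 (by lia)
    exact Or.inr (Or.inr (Or.inr ⟨L, 0, Or.inr rfl, h2, hm, by simp [loxRep, this, hlen]⟩))
  · interval_cases a <;> simp
  · have : L ≠ [] := List.length_pos_iff.1 (by lia)
    obtain ⟨j, rfl⟩ : ∃ j, k = j + 1 := ⟨k - 1, by lia⟩
    rw [show 2 * (j + 1) - 1 = 2 * j + 1 by lia] at hlen
    exact Or.inr (Or.inr (Or.inr ⟨L, 0, Or.inr rfl, h2, hm, by simp [loxRep, this, hlen]⟩))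

/-- The representation of the braid group on `ℤ²`. -/
def toSL : A2Group →* Matrix.SpecialLinearGroup (Fin 2) ℤ :=
  PresentedGroup.toGroup (f := fun b => bif b then matS else matT) (by
    rintro r rfl
    simp only [map_mul, map_inv, FreeGroup.lift_apply_of]
    decide)

/-- The abelianization of the braid group. -/
def len : A2Group →* Multiplicative ℤ :=
  PresentedGroup.toGroup (f := fun _ => Multiplicative.ofAdd 1) (by
    rintro r rfl
    simp only [map_mul, map_inv, FreeGroup.lift_apply_of]
    decide)

lemma isConj_of_mul_eq_mul {G : Type*} [Group G] {x y z : G} (h : x * z = z * y) : IsConj x y :=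
  (isConj_iff.2 ⟨z, by rw [← h, mul_inv_cancel_right]⟩ : IsConj y x).symm

lemma prod_map_mul_matS {L : List ℕ} (h2 : ∀ a ∈ L, 2 ≤ a) :
    (L.map fun a => toPSL matS ^ a * toPSL matX).prod * toPSL matS =
      toPSL matS * toPSL (word (code L)) := by
  induction L with
  | nil => simp [code, word_nil]
  | cons a L ih =>
    have ha := h2 a (by simp)
    obtain ⟨b, rfl⟩ : ∃ b, a = b + 2 := ⟨a - 2, by lia⟩
    have hC : toPSL matC = toPSL matS * toPSL matX * toPSL matS := by
      rw [← map_mul, ← map_mul, ← toPSL_neg]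
      exact congrArg toPSL (by decide)
    rw [List.map_cons, List.prod_cons, mul_assoc, ih fun c hc => h2 c (by simp [hc]), code,
      Nat.add_sub_cancel, word_append, word_replicate_true, word_false_cons, map_mul, map_mul,
      map_pow, hC, show b + 2 = 1 + b + 1 by lia, pow_add, pow_add, pow_one]
    simp only [mul_assoc]

variable {q : A2Monoid →* Matrix.ProjectiveSpecialLinearGroup (Fin 2) ℤ}

lemma map_w0B (hs : q sB = toPSL matS) (ht : q tB = toPSL matT) :
    q w0B = toPSL matX := by
  rw [w0B, map_mul, map_mul, hs, ht, ← map_mul, ← map_mul]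
  exact congrArg toPSL (by decide)

lemma map_altPow_mul (hs : q sB = toPSL matS) (ht : q tB = toPSL matT) (L : List ℕ) :
    q (altPow true L) * toPSL matX ^ L.length =
    (L.map fun a => toPSL matS ^ a * toPSL matX).prod := by
  induction L with
  | nil => simp [altPow]
  | cons a L ih =>
    have h := congrArg q (w0B_mul_altPow true L)
    rw [map_mul, map_mul, map_w0B hs ht] at h
    have hs' : q (a2Gen true) = toPSL matS := hs
    rw [altPow, map_mul, map_pow, hs', List.map_cons, List.prod_cons, ← ih, List.length_cons,
      pow_succ', mul_assoc, ← mul_assoc (q _), ← h]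
    simp only [mul_assoc]

lemma isConj_loxRep (hs : q sB = toPSL matS) (ht : q tB = toPSL matT)
    {L : List ℕ} {a : ℕ} (h0 : L = [] ∨ a = 0) (h2 : ∀ b ∈ L, 2 ≤ b) :
    IsConj (q (loxRep L a)) (toPSL (word (codeWord L a))) := by
  rcases eq_or_ne L [] with rfl | hne
  · simp only [loxRep, if_true, codeWord, code, List.nil_append, word_replicate_true, map_pow, hs]
    exact IsConj.refl _
  · obtain rfl := h0.resolve_left hne
    have h := prod_map_mul_matS h2
    rw [← map_altPow_mul hs ht, toPSL_matX_pow] at h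
    simp only [loxRep, hne, if_false, codeWord, List.replicate_zero, List.append_nil]
    rcases hb : L.length.bodd with _ | _
    · simp only [hb, Bool.toNat_false, pow_zero, mul_one] at h
      exact isConj_of_mul_eq_mul (z := toPSL matS) (by simpa using h)
    · simp only [hb, Bool.toNat_true, pow_one] at h
      refine isConj_of_mul_eq_mul (z := toPSL matX * toPSL matS) ?_
      rw [if_pos rfl, map_mul, map_w0B hs ht, mul_assoc, ← mul_assoc (q _), h, mul_assoc]

/-- A representative other than `𝐬𝐭`, `𝐰₀` and `𝐰₀𝐬` has trace at least `2` in absolute value. -/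
lemma not_isConj_loxRep (hs : q sB = toPSL matS) (ht : q tB = toPSL matT)
    {A : Matrix.SpecialLinearGroup (Fin 2) ℤ} (hA : |(A : Matrix (Fin 2) (Fin 2) ℤ).trace| < 2)
    {L : List ℕ} {a : ℕ} (h0 : L = [] ∨ a = 0) (h2 : ∀ b ∈ L, 2 ≤ b) :
    ¬ IsConj (toPSL A) (q (loxRep L a)) := by
  intro h
  have htr := abs_trace_eq_of_isConj (h.trans (isConj_loxRep hs ht h0 h2))
  have := two_le_abs_trace_word (codeWord L a)
  lia

/-- A representative of finite order in `PSL(2, ℤ)`, or one of the form `loxRep`. -/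
lemma Shape.trace_cases (hs : q sB = toPSL matS) (ht : q tB = toPSL matT) {y : A2Monoid}
    (hy : Shape y) :
    ((y = sB * tB ∨ y = w0B ∨ y = w0B * sB) ∧ ∃ A : Matrix.SpecialLinearGroup (Fin 2) ℤ,
      |(A : Matrix (Fin 2) (Fin 2) ℤ).trace| < 2 ∧ q y = toPSL A) ∨
    ∃ L a, (L = [] ∨ a = 0) ∧ (∀ b ∈ L, 2 ≤ b) ∧ CyclicallyMaximal L ∧ y = loxRep L a := by
  rcases hy.cases with rfl | rfl | rfl | h
  · exact Or.inl ⟨by simp, matS * matT, by decide, by rw [map_mul, map_mul, hs, ht]⟩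
  · exact Or.inl ⟨by simp, matX, by decide, map_w0B hs ht⟩
  · exact Or.inl ⟨by simp, matX * matS, by decide, by rw [map_mul, map_mul, hs, map_w0B hs ht]⟩
  · exact Or.inr h

lemma Shape.eq_of_isConj (hs : q sB = toPSL matS) (ht : q tB = toPSL matT)
    {l : A2Monoid →* Multiplicative ℤ} (ls : l sB = Multiplicative.ofAdd 1)
    (lt : l tB = Multiplicative.ofAdd 1) {y y' : A2Monoid} (hy : Shape y) (hy' : Shape y')
    (hq : IsConj (q y) (q y'))
    (hl : 6 ∣ Multiplicative.toAdd (l y) - Multiplicative.toAdd (l y')) : y = y' := by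
  rcases hy.trace_cases hs ht with ⟨hE, A, hA, hqA⟩ | ⟨L, a, h0, h2, hm, rfl⟩ <;>
    rcases hy'.trace_cases hs ht with ⟨hE', A', hA', hqA'⟩ | ⟨L', a', h0', h2', hm', rfl⟩
  · rcases hE with rfl | rfl | rfl <;> rcases hE' with rfl | rfl | rfl <;> first
      | rfl
      | simp [w0B, ls, lt] at hl
  · rw [hqA] at hq
    exact absurd hq (not_isConj_loxRep hs ht hA h0' h2')
  · rw [hqA'] at hq
    exact absurd hq.symm (not_isConj_loxRep hs ht hA' h0 h2)
  · obtain ⟨V, hV⟩ := exists_append_eq_append_of_isConj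
      (((isConj_loxRep hs ht h0 h2).symm.trans hq).trans (isConj_loxRep hs ht h0' h2'))
    obtain ⟨rfl, rfl⟩ := eq_of_codeWord h0 h0' h2 h2' hm hm' hV
    rfl

end Uniqueness

/-- For every element `w` of `B⁺` there exist a unique `n ≥ 0` and a
unique `y` in the list (i)–(v) such that `w` is conjugate in `B` to `π^n·y`. Here
`ι : B⁺ → B` is the canonical morphism, determined by `ι(𝐬) = 𝐬`, `ι(𝐭) = 𝐭`. -/
theorem stmt0 (ι : A2Monoid →* A2Group)
    (hι : ∀ g : Bool, ι (a2Gen g) = PresentedGroup.of g)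
    (w : A2Monoid) :
    ∃! p : ℕ × A2Monoid, Shape p.2 ∧ IsConj (ι w) (ι piB ^ p.1 * ι p.2) := by
  have hs : (toPSL.comp (toSL.comp ι)) sB = toPSL matS := by
    rw [MonoidHom.comp_apply, MonoidHom.comp_apply, sB, hι, toSL, PresentedGroup.toGroup.of]
    rfl
  have ht : (toPSL.comp (toSL.comp ι)) tB = toPSL matT := by
    rw [MonoidHom.comp_apply, MonoidHom.comp_apply, tB, hι, toSL, PresentedGroup.toGroup.of]
    rfl
  have hl : ∀ g, len (ι (a2Gen g)) = Multiplicative.ofAdd 1 := fun g => by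
    rw [hι, len, PresentedGroup.toGroup.of]
  have hπ : toPSL (toSL (ι piB)) = 1 := by
    have h := map_w0B hs ht
    simp only [MonoidHom.comp_apply] at h
    rw [piB, map_mul, map_mul, map_mul, h, toPSL_matX_sq]
  have hlπ : len (ι piB) = Multiplicative.ofAdd 6 := by
    simp only [piB, w0B, sB, tB, map_mul, hl]
    rfl
  obtain ⟨n, y, hy, hc⟩ := hasShape ι w
  rw [map_mul, map_pow] at hc
  refine ⟨(n, y), ⟨hy, hc⟩, ?_⟩
  rintro ⟨n', y'⟩ ⟨hy', hc'⟩
  simp only at hy' hc'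
  have hconj := hc'.symm.trans hc
  have hlen := isConj_iff_eq.1 (len.map_isConj hconj)
  rw [map_mul, map_mul, map_pow, map_pow, hlπ] at hlen
  have hlen' := congrArg Multiplicative.toAdd hlen
  simp only [toAdd_mul, toAdd_pow, toAdd_ofAdd, nsmul_eq_mul] at hlen'
  have hyy : y' = y := by
    refine hy'.eq_of_isConj hs ht (l := len.comp ι) (hl true) (hl false) hy ?_ ?_
    · simpa [hπ] using (toPSL.comp toSL).map_isConj hconj
    · simp only [MonoidHom.comp_apply]
      lia
  subst hyy
  rw [show n' = n by lia]
end

section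
/- The pair (W^σ, {w₀^I}_{I ∈ S/σ}), where I runs over the orbits of σ on S, is a Coxeter system. Moreover, if l′ denotes the length function of this Coxeter system, then for all u, v ∈ W^σ one has l′(uv) = l′(u) + l′(v) if and only if l(uv) = l(u) + l(v). -/
variable {B : Type*} {W : Type*} [Group W] {M : CoxeterMatrix B}

/-- The subgroup `W^σ` of fixed points of an automorphism `σ` of `W`. -/
def fixedSubgroup (σ : MulAut W) : Subgroup W :=
  MonoidHom.eqLocus σ.toMonoidHom (MonoidHom.id W)

/-- The set `S` of simple reflections of the Coxeter system `cs`. -/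
def simpleSet (cs : CoxeterSystem M W) : Set W := Set.range cs.simple

/-- `I` is an orbit of `σ` on `S`. -/
def IsOrbit (cs : CoxeterSystem M W) (σ : MulAut W) (I : Set W) : Prop :=
  ∃ s ∈ simpleSet cs, I = {w | ∃ n : ℤ, (σ ^ n) s = w}

/-- `w₀` is a longest element of the standard parabolic subgroup `W_I` generated by
`I`. -/
def IsLongestIn (cs : CoxeterSystem M W) (I : Set W) (w₀ : W) : Prop :=
  w₀ ∈ Subgroup.closure I ∧ ∀ v ∈ Subgroup.closure I, cs.length v ≤ cs.length w₀

theorem Function.End.mul_apply' {α : Type*} (f g : Function.End α) (a : α) :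
    (f * g) a = f (g a) := rfl

theorem Function.End.one_apply' {α : Type*} (a : α) : (1 : Function.End α) a = a := rfl

namespace CoxeterSystem

open Classical in
/-- The map `(t, ε) ↦ (s t s, ε + [t = s])` on `W × ℤ/2` attached to a simple reflection `s`. -/
noncomputable def signedConj (cs : CoxeterSystem M W) (i : B) : Function.End (W × ZMod 2) :=
  fun p => (cs.simple i * p.1 * cs.simple i, p.2 + if p.1 = cs.simple i then 1 else 0)

open Classical in
theorem signedConj_mul_pow_apply (cs : CoxeterSystem M W) (i j : B) (n : ℕ) (t : W) (e : ZMod 2) :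
    ((cs.signedConj i * cs.signedConj j) ^ n : Function.End (W × ZMod 2)) (t, e) =
      ((cs.simple i * cs.simple j) ^ n * t * (cs.simple j * cs.simple i) ^ n,
        e + ∑ r ∈ Finset.range (2 * n),
          if t = (cs.simple j * cs.simple i) ^ r * cs.simple j then 1 else 0) := by
  induction n with
  | zero => simp [Function.End.one_apply']
  | succ n ih =>
    have hinv : (cs.simple j * cs.simple i) ^ n = ((cs.simple i * cs.simple j) ^ n)⁻¹ := by
      rw [← inv_pow]; simp
    have hsemi : cs.simple j * (cs.simple i * cs.simple j) ^ n =
        (cs.simple j * cs.simple i) ^ n * cs.simple j :=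
      (SemiconjBy.pow_right (show SemiconjBy (cs.simple j) (cs.simple i * cs.simple j)
        (cs.simple j * cs.simple i) by simp [SemiconjBy, mul_assoc]) n)
    have h1 : (cs.simple i * cs.simple j) ^ n * t * (cs.simple j * cs.simple i) ^ n
        = cs.simple j ↔ t = (cs.simple j * cs.simple i) ^ (2 * n) * cs.simple j := by
      rw [two_mul, pow_add, mul_assoc _ _ (cs.simple j), ← hsemi, hinv]
      constructor
      · intro h
        generalize (cs.simple i * cs.simple j) ^ n = x at h ⊢
        simp only [← h, mul_assoc, inv_mul_cancel_left, inv_mul_cancel, mul_one]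
      · rintro rfl; group
    have h2 : cs.simple j * ((cs.simple i * cs.simple j) ^ n * t *
        (cs.simple j * cs.simple i) ^ n) * cs.simple j
        = cs.simple i ↔ t = (cs.simple j * cs.simple i) ^ (2 * n + 1) * cs.simple j := by
      have : (cs.simple j * cs.simple i) ^ (2 * n + 1) * cs.simple j =
          ((cs.simple i * cs.simple j) ^ n)⁻¹ * (cs.simple j * cs.simple i * cs.simple j) *
            (cs.simple i * cs.simple j) ^ n := by
        rw [← hinv, mul_assoc (_ ^ n), mul_assoc (_ * _) (cs.simple j), hsemi, ← mul_assoc,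
          ← mul_assoc, ← pow_succ, ← pow_add]
        congr 2
        omega
      rw [this, hinv]
      have hj := cs.simple_mul_simple_self j
      constructor
      · intro h
        generalize (cs.simple i * cs.simple j) ^ n = x at h ⊢
        simp only [← h, mul_assoc, cs.simple_mul_simple_cancel_left, hj, inv_mul_cancel_left,
          inv_mul_cancel, mul_one]
      · rintro rfl
        simp only [mul_assoc, mul_inv_cancel_left, mul_inv_cancel, mul_one, hj,
          cs.simple_mul_simple_cancel_left]
    rw [pow_succ', Function.End.mul_apply', ih, Function.End.mul_apply', mul_add, mul_one, Finset.sum_range_succ, Finset.sum_range_succ]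
    ext1
    · simp only [signedConj, pow_succ, pow_succ' (cs.simple i * _), mul_assoc]
    · simp only [signedConj, h1, h2, add_assoc]

theorem isLiftable_signedConj (cs : CoxeterSystem M W) : M.IsLiftable cs.signedConj := by
  classical
  intro i j
  funext ⟨t, e⟩
  rw [signedConj_mul_pow_apply, simple_mul_simple_pow, simple_mul_simple_pow', two_mul,
    Finset.sum_range_add]
  simp only [pow_add, cs.simple_mul_simple_pow', one_mul, mul_one]
  rw [CharTwo.add_self_eq_zero, add_zero]
  rfl

/-- The action of `W` on `W × ℤ/2` extending `signedConj`. -/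
noncomputable def signedAction (cs : CoxeterSystem M W) : W →* Function.End (W × ZMod 2) :=
  cs.lift ⟨_, cs.isLiftable_signedConj⟩

/-- The parity of the number of occurrences of `t` in the right inversion sequence of any word
for `w`. -/
noncomputable def inversionParity (cs : CoxeterSystem M W) (w t : W) : ZMod 2 :=
  (cs.signedAction w (t, 0)).2

theorem signedAction_apply (cs : CoxeterSystem M W) (w t : W) (e : ZMod 2) :
    cs.signedAction w (t, e) = (w * t * w⁻¹, e + cs.inversionParity w t) := by
  classical
  unfold inversionParity
  induction w using cs.simple_induction_left generalizing e with
  | one => simp [Function.End.one_apply']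
  | mul_simple_left w i ih =>
    rw [map_mul, Function.End.mul_apply', Function.End.mul_apply', ih e, ih 0]
    simp [signedAction, lift_apply_simple, signedConj, mul_assoc, add_assoc]

theorem inversionParity_mul (cs : CoxeterSystem M W) (x y t : W) :
    cs.inversionParity (x * y) t =
      cs.inversionParity y t + cs.inversionParity x (y * t * y⁻¹) := by
  rw [inversionParity, map_mul, Function.End.mul_apply', signedAction_apply,
    signedAction_apply, zero_add]

open Classical in
theorem inversionParity_simple (cs : CoxeterSystem M W) (i : B) (t : W) :
    cs.inversionParity (cs.simple i) t = if t = cs.simple i then 1 else 0 := by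
  simp [inversionParity, signedAction, lift_apply_simple, signedConj]

theorem inversionParity_one (cs : CoxeterSystem M W) (t : W) : cs.inversionParity 1 t = 0 := by
  simp [inversionParity, Function.End.one_apply']

theorem IsReflection.inversionParity_self {cs : CoxeterSystem M W} {t : W}
    (ht : cs.IsReflection t) : cs.inversionParity t t = 1 := by
  obtain ⟨v, i, rfl⟩ := ht
  have h := cs.inversionParity_mul v v⁻¹ (v * cs.simple i * v⁻¹)
  rw [mul_inv_cancel, inversionParity_one] at h
  rw [inversionParity_mul, inversionParity_mul]
  simp only [mul_assoc, inv_mul_cancel_left, inv_inv, inv_mul_cancel, mul_one, inv_simple,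
    simple_mul_simple_self, one_mul, inversionParity_simple, if_true] at h ⊢
  linear_combination -h

theorem mem_rightInvSeq_of_inversionParity_ne_zero (cs : CoxeterSystem M W) {ω : List B} {t : W}
    (h : cs.inversionParity (cs.wordProd ω) t ≠ 0) : t ∈ cs.rightInvSeq ω := by
  classical
  induction ω with
  | nil => simp [inversionParity_one] at h
  | cons i ω ih =>
    rw [rightInvSeq, List.mem_cons]
    by_cases h' : cs.inversionParity (cs.wordProd ω) t = 0
    · left
      rw [wordProd_cons, inversionParity_mul, h', zero_add, inversionParity_simple] at h
      simp only [ne_eq, ite_eq_right_iff, Classical.not_imp] at h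
      rw [← h.1]; group
    · exact .inr (ih h')

theorem IsReflection.inversionParity_eq_one_iff {cs : CoxeterSystem M W} {t : W}
    (ht : cs.IsReflection t) (w : W) :
    cs.inversionParity w t = 1 ↔ cs.length (w * t) < cs.length w := by
  have key : ∀ w, cs.inversionParity w t = 1 → cs.length (w * t) < cs.length w := by
    intro w h
    obtain ⟨ω, hω, rfl⟩ := cs.exists_isReduced w
    exact (cs.isRightInversion_of_mem_rightInvSeq hω
      (cs.mem_rightInvSeq_of_inversionParity_ne_zero (by rw [h]; decide))).2
  refine ⟨key w, fun h => ?_⟩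
  by_contra h1
  have h0 : cs.inversionParity w t = 0 := by
    generalize cs.inversionParity w t = a at *
    revert h1; revert a; decide
  have := key (w * t) (by
    rw [inversionParity_mul, ht.inversionParity_self, mul_inv_cancel_right, h0, add_zero])
  rw [mul_assoc, ht.mul_self, mul_one] at this
  omega

/-- The strong exchange property. -/
theorem exists_wordProd_eraseIdx (cs : CoxeterSystem M W) {ω : List B} {t : W}
    (ht : cs.IsReflection t) (h : cs.length (cs.wordProd ω * t) < cs.length (cs.wordProd ω)) :
    ∃ j < ω.length, cs.wordProd ω * t = cs.wordProd (ω.eraseIdx j) := by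
  have hmem := cs.mem_rightInvSeq_of_inversionParity_ne_zero (ω := ω) (t := t)
    (by rw [(ht.inversionParity_eq_one_iff _).2 h]; decide)
  obtain ⟨j, hj, rfl⟩ := List.getElem_of_mem hmem
  refine ⟨j, by simpa using hj, ?_⟩
  rw [← cs.wordProd_mul_getD_rightInvSeq, List.getD_eq_getElem _ _ hj]

/-- Inversions of a product. -/
theorem IsReflection.length_mul_mul_lt_iff {cs : CoxeterSystem M W} {t : W}
    (ht : cs.IsReflection t) (x y : W) (hy : cs.length y < cs.length (y * t)) :
    cs.length (x * y * t) < cs.length (x * y) ↔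
      cs.length (x * (y * t * y⁻¹)) < cs.length x := by
  rw [← ht.inversionParity_eq_one_iff, ← (ht.conj y).inversionParity_eq_one_iff,
    inversionParity_mul]
  have h1 : cs.inversionParity y t ≠ 1 := by
    rw [ne_eq, ht.inversionParity_eq_one_iff]; omega
  have h0 : cs.inversionParity y t = 0 := by
    generalize cs.inversionParity y t = a at *
    revert h1; revert a; decide
  rw [h0, zero_add]

end CoxeterSystem

namespace CoxeterSystem

theorem length_mul_simple_of_lt {cs : CoxeterSystem M W} {w : W} {i : B}
    (h : cs.length (w * cs.simple i) < cs.length w) :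
    cs.length (w * cs.simple i) + 1 = cs.length w :=
  (cs.length_mul_simple w i).resolve_left (by omega)

theorem wordProd_mem_closure (cs : CoxeterSystem M W) {K : Set W} {ω : List B}
    (hω : ∀ i ∈ ω, cs.simple i ∈ K) : cs.wordProd ω ∈ Subgroup.closure K := by
  refine Subgroup.list_prod_mem _ fun x hx => ?_
  obtain ⟨i, hi, rfl⟩ := List.mem_map.1 hx
  exact Subgroup.subset_closure (hω i hi)

theorem exists_isReduced_of_mem_closure (cs : CoxeterSystem M W) {K : Set W}
    (hK : K ⊆ Set.range cs.simple) {x : W} (hx : x ∈ Subgroup.closure K) :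
    ∃ ω : List B, (∀ i ∈ ω, cs.simple i ∈ K) ∧ cs.IsReduced ω ∧ cs.wordProd ω = x := by
  have step : ∀ x y : W, y ∈ K →
      (∃ ω : List B, (∀ i ∈ ω, cs.simple i ∈ K) ∧ cs.IsReduced ω ∧ cs.wordProd ω = x) →
      ∃ ω : List B, (∀ i ∈ ω, cs.simple i ∈ K) ∧ cs.IsReduced ω ∧ cs.wordProd ω = x * y := by
    rintro _ y hy ⟨ω, hωK, hω, rfl⟩
    obtain ⟨i, rfl⟩ := hK hy
    rcases cs.length_mul_simple (cs.wordProd ω) i with h | h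
    · refine ⟨ω.concat i, ?_, ?_, cs.wordProd_concat i ω⟩
      · intro j hj
        rw [List.concat_eq_append, List.mem_append, List.mem_singleton] at hj
        rcases hj with hj | rfl
        exacts [hωK j hj, hy]
      · rw [IsReduced, cs.wordProd_concat, h, hω, List.length_concat]
    · obtain ⟨j, hj, hj'⟩ := cs.exists_wordProd_eraseIdx (cs.isReflection_simple i)
        (by omega : cs.length (cs.wordProd ω * cs.simple i) < _)
      refine ⟨ω.eraseIdx j, fun k hk => hωK k (List.mem_of_mem_eraseIdx hk), ?_, hj'.symm⟩
      have := List.length_eraseIdx_add_one hj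
      rw [hω] at h
      rw [IsReduced, ← hj']
      omega
  induction hx using Subgroup.closure_induction_right with
  | one => exact ⟨[], by simp, by simp [IsReduced], by simp⟩
  | mul_right x _ y hy ih => exact step x y hy ih
  | mul_inv_cancel x _ y hy ih =>
    have : y⁻¹ = y := by obtain ⟨i, rfl⟩ := hK hy; simp
    rw [this]
    exact step x y hy ih

theorem exists_descent_of_mem_closure (cs : CoxeterSystem M W) {K : Set W}
    (hK : K ⊆ Set.range cs.simple) {x : W} (hx : x ∈ Subgroup.closure K) (h1 : x ≠ 1) :
    ∃ s ∈ K, cs.length (x * s) < cs.length x := by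
  obtain ⟨ω, hωK, hω, rfl⟩ := cs.exists_isReduced_of_mem_closure hK hx
  rcases List.eq_nil_or_concat ω with rfl | ⟨ω, i, rfl⟩
  · simp at h1
  · refine ⟨cs.simple i, hωK i (by simp), ?_⟩
    rw [hω, cs.wordProd_concat, cs.simple_mul_simple_cancel_right,
      List.length_concat]
    exact Nat.lt_succ_of_le (cs.length_wordProd_le ω)

theorem mem_closure_of_length_mul_lt (cs : CoxeterSystem M W) {K : Set W}
    (hK : K ⊆ Set.range cs.simple) {x : W} (hx : x ∈ Subgroup.closure K) {t : W}
    (ht : cs.IsReflection t) (h : cs.length (x * t) < cs.length x) :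
    t ∈ Subgroup.closure K := by
  obtain ⟨ω, hωK, hω, rfl⟩ := cs.exists_isReduced_of_mem_closure hK hx
  obtain ⟨j, hj, hj'⟩ := cs.exists_wordProd_eraseIdx ht h
  have := cs.wordProd_mem_closure (K := K) (ω := ω.eraseIdx j)
    fun k hk => hωK k (List.mem_of_mem_eraseIdx hk)
  rw [← hj'] at this
  exact (Subgroup.mul_mem_cancel_left _ hx).1 this

theorem simple_mem_of_mem_closure (cs : CoxeterSystem M W) {K : Set W}
    (hK : K ⊆ Set.range cs.simple) {i : B} (hi : cs.simple i ∈ Subgroup.closure K) :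
    cs.simple i ∈ K := by
  obtain ⟨s, hs, h⟩ := cs.exists_descent_of_mem_closure hK hi (by
    rw [ne_eq, ← cs.length_eq_zero_iff, length_simple]; exact one_ne_zero)
  rw [length_simple, Nat.lt_one_iff, length_eq_zero_iff] at h
  rwa [← inv_simple, inv_eq_of_mul_eq_one_right h]

/-- Induction on elements of a standard parabolic subgroup along right multiplication by ascents. -/
theorem closure_induction_ascent (cs : CoxeterSystem M W) {K : Set W}
    (hK : K ⊆ Set.range cs.simple) {p : W → Prop} (one : p 1)
    (mul : ∀ y ∈ Subgroup.closure K, ∀ i : B, cs.simple i ∈ K →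
      cs.length (y * cs.simple i) = cs.length y + 1 → p y → p (y * cs.simple i))
    {x : W} (hx : x ∈ Subgroup.closure K) : p x := by
  induction hn : cs.length x using Nat.strong_induction_on generalizing x with
  | _ n ih =>
    by_cases h1 : x = 1
    · exact h1 ▸ one
    obtain ⟨s, hs, h⟩ := cs.exists_descent_of_mem_closure hK hx h1
    obtain ⟨i, rfl⟩ := hK hs
    have hx' := Subgroup.mul_mem _ hx (Subgroup.subset_closure hs)
    have := mul _ hx' i hs (by
      rw [simple_mul_simple_cancel_right]; exact (length_mul_simple_of_lt h).symm)
      (ih _ (hn ▸ h) hx' rfl)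
    rwa [simple_mul_simple_cancel_right] at this

theorem length_mul_of_forall_le (cs : CoxeterSystem M W) {K : Set W}
    (hK : K ⊆ Set.range cs.simple) {w : W}
    (hw : ∀ v ∈ Subgroup.closure K, cs.length w ≤ cs.length (w * v))
    {x : W} (hx : x ∈ Subgroup.closure K) :
    cs.length (w * x) = cs.length w + cs.length x := by
  refine cs.closure_induction_ascent hK
    (p := fun x => cs.length (w * x) = cs.length w + cs.length x) (by simp) ?_ hx
  intro y hy i hi h ih
  have h2 := (cs.isReflection_simple i).length_mul_mul_lt_iff w y (by omega)
  have h3 := hw (y * cs.simple i * y⁻¹)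
    (mul_mem (mul_mem hy (Subgroup.subset_closure hi)) (inv_mem hy))
  have h4 := cs.length_mul_simple (w * y) i
  rw [← mul_assoc]
  omega

/-- Every coset of a standard parabolic subgroup has a distinguished representative. -/
theorem exists_eq_mul_of_closure (cs : CoxeterSystem M W) {K : Set W}
    (hK : K ⊆ Set.range cs.simple) (w : W) :
    ∃ w' : W, ∃ x ∈ Subgroup.closure K, w = w' * x ∧
      ∀ y ∈ Subgroup.closure K, cs.length (w' * y) = cs.length w' + cs.length y := by
  let A : Set ℕ := {n | ∃ v ∈ Subgroup.closure K, cs.length (w * v) = n}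
  have hA : A.Nonempty := ⟨_, 1, one_mem _, rfl⟩
  obtain ⟨v, hv, hv'⟩ := Nat.sInf_mem hA
  refine ⟨w * v, v⁻¹, inv_mem hv, by simp, fun y hy => cs.length_mul_of_forall_le hK ?_ hy⟩
  intro u hu
  rw [hv', mul_assoc]
  exact Nat.sInf_le ⟨v * u, mul_mem hv hu, rfl⟩

theorem length_mul_of_mem_closure (cs : CoxeterSystem M W) {K : Set W}
    (hK : K ⊆ Set.range cs.simple) {w : W}
    (hw : ∀ s ∈ K, cs.length w < cs.length (w * s))
    {x : W} (hx : x ∈ Subgroup.closure K) :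
    cs.length (w * x) = cs.length w + cs.length x := by
  obtain ⟨w', y, hy, rfl, h⟩ := cs.exists_eq_mul_of_closure hK w
  by_cases h1 : y = 1
  · subst h1
    simpa using h x hx
  · obtain ⟨s, hs, hlt⟩ := cs.exists_descent_of_mem_closure hK hy h1
    have h2 := hw s hs
    rw [mul_assoc, h _ hy, h _ (mul_mem hy (Subgroup.subset_closure hs))] at h2
    omega

end CoxeterSystem

namespace IsLongestIn

open CoxeterSystem

variable {cs : CoxeterSystem M W} {K : Set W} {u : W}

theorem inv (hu : IsLongestIn cs K u) : IsLongestIn cs K u⁻¹ :=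
  ⟨inv_mem hu.1, fun v hv => by rw [cs.length_inv]; exact hu.2 v hv⟩

theorem length_mul_add (hu : IsLongestIn cs K u) (hK : K ⊆ Set.range cs.simple) {v : W}
    (hv : v ∈ Subgroup.closure K) : cs.length (u * v) + cs.length v = cs.length u := by
  refine cs.closure_induction_ascent hK
    (p := fun v => cs.length (u * v) + cs.length v = cs.length u) (by simp) ?_ hv
  intro y hy i hi h ih
  have h2 := (cs.isReflection_simple i).length_mul_mul_lt_iff u y (by omega)
  have h3 := hu.2 (u * (y * cs.simple i * y⁻¹))
    (mul_mem hu.1 (mul_mem (mul_mem hy (Subgroup.subset_closure hi)) (inv_mem hy)))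
  have h5 := ((cs.isReflection_simple i).conj y).length_mul_left_ne u
  have h4 := cs.length_mul_simple (u * y) i
  rw [← mul_assoc]
  omega

theorem length_mul_lt (hu : IsLongestIn cs K u) (hK : K ⊆ Set.range cs.simple) {s : W}
    (hs : s ∈ K) : cs.length (u * s) < cs.length u := by
  have := hu.length_mul_add hK (Subgroup.subset_closure hs)
  obtain ⟨i, rfl⟩ := hK hs
  rw [cs.length_simple] at this
  omega

/-- An element of `W_K` all of whose right multiples by elements of `K` are shorter is the longest
one. -/
theorem eq_of_forall_lt (hu : IsLongestIn cs K u) (hK : K ⊆ Set.range cs.simple) {x : W}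
    (hx : x ∈ Subgroup.closure K) (h : ∀ s ∈ K, cs.length (x * s) < cs.length x) : x = u := by
  have h1 := hu.inv.length_mul_add hK hx
  have hy : u⁻¹ * x ∈ Subgroup.closure K := mul_mem (inv_mem hu.1) hx
  by_contra hne
  obtain ⟨s, hs, hlt⟩ := cs.exists_descent_of_mem_closure hK hy
    (fun h => hne (inv_mul_eq_one.1 h).symm)
  have h2 := cs.length_mul_le (x * s) (u⁻¹ * x * s)⁻¹
  obtain ⟨i, rfl⟩ := hK hs
  have h3 : x * cs.simple i * (u⁻¹ * x * cs.simple i)⁻¹ = u := by group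
  have h4 := h _ hs
  rw [h3, cs.length_inv] at h2
  rw [cs.length_inv] at h1
  omega

theorem eq (hu : IsLongestIn cs K u) (hK : K ⊆ Set.range cs.simple) {v : W}
    (hv : IsLongestIn cs K v) : u = v :=
  hv.eq_of_forall_lt hK hu.1 fun _ hs => hu.length_mul_lt hK hs

theorem inv_eq (hu : IsLongestIn cs K u) (hK : K ⊆ Set.range cs.simple) : u⁻¹ = u :=
  hu.inv.eq hK hu

theorem mul_self (hu : IsLongestIn cs K u) (hK : K ⊆ Set.range cs.simple) : u * u = 1 := by
  nth_rw 1 [← hu.inv_eq hK]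
  exact inv_mul_cancel u

theorem length_pos (hu : IsLongestIn cs K u) (hK : K ⊆ Set.range cs.simple) (hne : K.Nonempty) :
    0 < cs.length u := by
  obtain ⟨s, hs⟩ := hne
  exact (Nat.zero_le _).trans_lt (hu.length_mul_lt hK hs)

theorem _root_.exists_isLongestIn [Finite W] (cs : CoxeterSystem M W) (K : Set W) :
    ∃ u, IsLongestIn cs K u := by
  obtain ⟨u, hu, h⟩ := (Set.toFinite (Subgroup.closure K : Set W)).exists_maximalFor cs.length _
    ⟨1, one_mem _⟩
  exact ⟨u, hu, fun v hv => (le_total _ _).elim id fun h' => h hv h'⟩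

end IsLongestIn

open CoxeterSystem

/-- A family of sets `K I` of simple reflections covering the set of simple reflections, together
with a subgroup `G` containing the distinct longest elements `w I` of the corresponding standard
parabolic subgroups, such that each element of `G` has all or none of the elements of each `K I`
among its right descents. -/
structure IsAdaptedFamily (cs : CoxeterSystem M W) (G : Subgroup W) {O : Type*} (K : O → Set W)
    (w : O → G) : Prop where
  iUnion_eq : ⋃ I, K I = Set.range cs.simple
  nonempty : ∀ I, (K I).Nonempty
  isLongestIn : ∀ I, IsLongestIn cs (K I) (w I)
  injective : Function.Injective w
  descent : ∀ (x : G) (I : O), ∀ s ∈ K I, cs.length (x * s) < cs.length (x : W) →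
    ∀ s' ∈ K I, cs.length (x * s') < cs.length (x : W)

namespace IsAdaptedFamily

variable {cs : CoxeterSystem M W} {G : Subgroup W} {O : Type*} {K : O → Set W} {w : O → G}

theorem subset (h : IsAdaptedFamily cs G K w) (I : O) : K I ⊆ Set.range cs.simple :=
  h.iUnion_eq ▸ Set.subset_iUnion K I

theorem mul_self (h : IsAdaptedFamily cs G K w) (I : O) : w I * w I = 1 :=
  Subtype.ext ((h.isLongestIn I).mul_self (h.subset I))

theorem length_pos (h : IsAdaptedFamily cs G K w) (I : O) : 0 < cs.length (w I : W) :=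
  (h.isLongestIn I).length_pos (h.subset I) (h.nonempty I)

theorem ascent_or_descent (h : IsAdaptedFamily cs G K w) (x : G) (I : O) :
    (∀ s ∈ K I, cs.length (x : W) < cs.length (x * s)) ∨
      (∀ s ∈ K I, cs.length (x * s) < cs.length (x : W)) := by
  by_cases hx : ∃ s ∈ K I, cs.length (x * s) < cs.length (x : W)
  · obtain ⟨s, hs, hlt⟩ := hx
    exact .inr (h.descent x I s hs hlt)
  · refine .inl fun s hs => ?_
    have h1 : ¬ cs.length (x * s) < cs.length (x : W) := fun h1 => hx ⟨s, hs, h1⟩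
    obtain ⟨i, rfl⟩ := h.subset I hs
    have := cs.length_mul_simple_ne x i
    omega

theorem length_mul_of_ascent (h : IsAdaptedFamily cs G K w) {x : W} {I : O}
    (hx : ∀ s ∈ K I, cs.length x < cs.length (x * s)) :
    cs.length (x * w I) = cs.length x + cs.length (w I : W) :=
  cs.length_mul_of_mem_closure (h.subset I) hx (h.isLongestIn I).1

theorem length_mul_of_descent (h : IsAdaptedFamily cs G K w) {x : W} {I : O}
    (hx : ∀ s ∈ K I, cs.length (x * s) < cs.length x) :
    cs.length (x * w I) + cs.length (w I : W) = cs.length x := by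
  obtain ⟨x', y, hy, rfl, h'⟩ := cs.exists_eq_mul_of_closure (h.subset I) x
  have hyw : y = w I := by
    refine (h.isLongestIn I).eq_of_forall_lt (h.subset I) hy fun s hs => ?_
    have := hx s hs
    rw [mul_assoc, h' _ hy, h' _ (mul_mem hy (Subgroup.subset_closure hs))] at this
    omega
  rw [h' y hy, hyw, mul_assoc, ← Subgroup.coe_mul, h.mul_self I, Subgroup.coe_one, mul_one]

theorem descent_of_length_mul (h : IsAdaptedFamily cs G K w) {x : W} {I : O}
    (hx : cs.length (x * w I) = cs.length x + cs.length (w I : W)) :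
    ∀ s ∈ K I, cs.length (x * w I * s) < cs.length (x * w I) := by
  intro s hs
  have h1 := cs.length_mul_le x (w I * s)
  have h2 := (h.isLongestIn I).length_mul_lt (h.subset I) hs
  rw [← mul_assoc] at h1
  omega

/-- The sum of the lengths of the letters of a word in the `w I`. -/
noncomputable def weight (cs : CoxeterSystem M W) (w : O → G) (ω : List O) : ℕ :=
  (ω.map fun I => cs.length (w I : W)).sum

theorem weight_concat (ω : List O) (I : O) :
    weight cs w (ω.concat I) = weight cs w ω + cs.length (w I : W) := by
  simp [weight]

theorem weight_alternatingWord_lt (h : IsAdaptedFamily cs G K w) (I J : O) (k : ℕ) :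
    weight cs w (alternatingWord I J k) <
      weight cs w (alternatingWord J I k) + cs.length (w J : W) := by
  rw [← weight_concat, ← alternatingWord_succ, alternatingWord_succ', weight, weight,
    List.map_cons, List.sum_cons]
  exact Nat.lt_add_of_pos_left (h.length_pos _)

/-- The Coxeter matrix of the orders of the products of two longest elements. -/
noncomputable def coxeterMatrix [Finite W] (h : IsAdaptedFamily cs G K w) : CoxeterMatrix O where
  M := Matrix.of fun I J => orderOf (w I * w J)
  isSymm := by
    ext I J
    have : w I * w J = (w J * w I)⁻¹ := by
      rw [mul_inv_rev, inv_eq_of_mul_eq_one_right (h.mul_self I),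
        inv_eq_of_mul_eq_one_right (h.mul_self J)]
    rw [Matrix.transpose_apply, Matrix.of_apply, Matrix.of_apply, this, orderOf_inv]
  diagonal I := by rw [Matrix.of_apply, h.mul_self, orderOf_one]
  off_diagonal I J hIJ h1 := hIJ <| h.injective <| by
    rw [Matrix.of_apply, orderOf_eq_one_iff] at h1
    rw [← inv_eq_of_mul_eq_one_right (h.mul_self J)]
    exact eq_inv_of_mul_eq_one_left h1

variable [Finite W]

theorem coxeterMatrix_apply (h : IsAdaptedFamily cs G K w) (I J : O) :
    h.coxeterMatrix I J = orderOf (w I * w J) := rfl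

theorem coxeterMatrix_ne_zero (h : IsAdaptedFamily cs G K w) (I J : O) :
    h.coxeterMatrix I J ≠ 0 := (orderOf_pos (w I * w J)).ne'

/-- The Coxeter system of the abstract Coxeter group on the longest elements `w I`. -/
noncomputable def coxeterSystem (h : IsAdaptedFamily cs G K w) :
    CoxeterSystem h.coxeterMatrix h.coxeterMatrix.Group :=
  h.coxeterMatrix.toCoxeterSystem

/-- The map from the abstract Coxeter group on the `w I` to `G`. -/
noncomputable def hom (h : IsAdaptedFamily cs G K w) : h.coxeterMatrix.Group →* G :=
  h.coxeterSystem.lift ⟨w, fun I J => pow_orderOf_eq_one (w I * w J)⟩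

@[simp]
theorem hom_simple (h : IsAdaptedFamily cs G K w) (I : O) :
    h.hom (h.coxeterSystem.simple I) = w I :=
  h.coxeterSystem.lift_apply_simple _ I

/-- The image in `G` of an alternating word. -/
noncomputable def alternating (h : IsAdaptedFamily cs G K w) (I J : O) (k : ℕ) : G :=
  h.hom (h.coxeterSystem.wordProd (alternatingWord I J k))

theorem alternating_zero (h : IsAdaptedFamily cs G K w) (I J : O) : h.alternating I J 0 = 1 := by
  simp [alternating, alternatingWord]

theorem alternating_succ (h : IsAdaptedFamily cs G K w) (I J : O) (k : ℕ) :
    h.alternating I J (k + 1) = h.alternating J I k * w J := by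
  rw [alternating, alternatingWord_succ, wordProd_concat, map_mul, hom_simple, alternating]

theorem alternating_eq (h : IsAdaptedFamily cs G K w) (I J : O) (k : ℕ) :
    h.alternating I J k = (if Even k then 1 else w J) * (w I * w J) ^ (k / 2) := by
  rw [alternating, prod_alternatingWord_eq_mul_pow]
  split_ifs <;> simp

theorem pow_eq_one_of_alternating_eq (h : IsAdaptedFamily cs G K w) {I J : O} {k : ℕ}
    (hk : h.alternating I J k = h.alternating J I k) : (w I * w J) ^ k = 1 := by
  have hI := inv_eq_of_mul_eq_one_right (h.mul_self I)
  have hJ := inv_eq_of_mul_eq_one_right (h.mul_self J)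
  have hinv : w J * w I = (w I * w J)⁻¹ := by rw [mul_inv_rev, hI, hJ]
  rw [alternating_eq, alternating_eq, hinv] at hk
  rcases Nat.even_or_odd' k with ⟨m, rfl | rfl⟩
  · simp only [even_two, Even.mul_right, if_true, one_mul, inv_pow, Nat.mul_div_cancel_left _
      two_pos] at hk
    rw [two_mul, pow_add]
    nth_rw 1 [hk]
    exact inv_mul_cancel _
  · have hm : (2 * m + 1) / 2 = m := by omega
    simp only [Nat.not_even_bit1, if_false, hm, inv_pow] at hk
    rw [pow_succ', two_mul, pow_add]
    have : (w I * w J) * ((w I * w J) ^ m * (w I * w J) ^ m) =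
      w I * (w J * (w I * w J) ^ m) * (w I * w J) ^ m := by simp only [mul_assoc]
    rw [this, hk, ← mul_assoc, h.mul_self, one_mul, inv_mul_cancel]

theorem alternating_mem_closure (h : IsAdaptedFamily cs G K w) (I J : O) (k : ℕ) :
    (h.alternating I J k : W) ∈ Subgroup.closure (K I ∪ K J) := by
  induction k generalizing I J with
  | zero => simp [alternating_zero]
  | succ k ih =>
    rw [alternating_succ, Subgroup.coe_mul]
    exact mul_mem (Set.union_comm (K I) (K J) ▸ ih J I)
      (Subgroup.closure_mono Set.subset_union_right (h.isLongestIn J).1)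

theorem alternating_ascent (h : IsAdaptedFamily cs G K w) (k : ℕ) (I J : O)
    (hk : k < h.coxeterMatrix I J) :
    ∀ s ∈ K I, cs.length (h.alternating I J k : W) < cs.length (h.alternating I J k * s) := by
  induction k using Nat.strong_induction_on generalizing I J with
  | _ k ih =>
  have hlen : ∀ j ≤ k, ∀ I J, k < h.coxeterMatrix I J →
      cs.length (h.alternating I J j : W) = weight cs w (alternatingWord I J j) := by
    intro j
    induction j with
    | zero => intros; simp [alternating_zero, alternatingWord, weight]
    | succ j ihj =>
      intro hj I J hk
      rw [h.coxeterMatrix.symmetric] at hk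
      rw [alternatingWord_succ, weight_concat, alternating_succ, Subgroup.coe_mul,
        h.length_mul_of_ascent (ih j (by omega) J I (by omega)), ihj (by omega) J I hk]
  have hdesc : ∀ I J, 0 < k → k < h.coxeterMatrix I J →
      ∀ s ∈ K J, cs.length (h.alternating I J k * s) < cs.length (h.alternating I J k : W) := by
    intro I J h0 hk
    obtain ⟨j, rfl⟩ := Nat.exists_eq_succ_of_ne_zero h0.ne'
    rw [h.coxeterMatrix.symmetric] at hk
    rw [Nat.succ_eq_add_one, alternating_succ, Subgroup.coe_mul]
    exact h.descent_of_length_mul (h.length_mul_of_ascent (ih j (by omega) J I (by omega)))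
  refine (h.ascent_or_descent _ I).resolve_right fun hI => ?_
  have h0 : 0 < k := by
    by_contra h0
    obtain ⟨s, hs⟩ := h.nonempty I
    have := hI s hs
    rw [Nat.eq_zero_of_not_pos h0, alternating_zero] at this
    simp at this
  obtain ⟨u, hu⟩ := exists_isLongestIn cs (K I ∪ K J)
  have hsub : K I ∪ K J ⊆ Set.range cs.simple := Set.union_subset (h.subset I) (h.subset J)
  have hIJ : (h.alternating I J k : W) = u :=
    hu.eq_of_forall_lt hsub (h.alternating_mem_closure I J k)
      fun s hs => hs.elim (hI s) (hdesc I J h0 hk s)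
  have hk' : k < h.coxeterMatrix J I := by rwa [h.coxeterMatrix.symmetric]
  have hmem : (h.alternating J I k : W) ∈ Subgroup.closure (K I ∪ K J) :=
    Set.union_comm (K J) (K I) ▸ h.alternating_mem_closure J I k
  have hJ := (h.ascent_or_descent (h.alternating J I k) J).resolve_left fun hJ => by
    have h1 := h.length_mul_of_ascent hJ
    have h2 := hu.2 _ (mul_mem hmem
      (Subgroup.closure_mono Set.subset_union_right (h.isLongestIn J).1))
    have h3 := h.weight_alternatingWord_lt I J k
    rw [h1, ← hIJ, hlen k le_rfl I J hk, hlen k le_rfl J I hk'] at h2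
    omega
  have hJI : (h.alternating J I k : W) = u :=
    hu.eq_of_forall_lt hsub hmem fun s hs => hs.elim (hdesc J I h0 hk' s) (hJ s)
  have := orderOf_dvd_of_pow_eq_one
    (h.pow_eq_one_of_alternating_eq (Subtype.ext (hIJ.trans hJI.symm)))
  exact absurd (Nat.le_of_dvd h0 this) (by rw [← h.coxeterMatrix_apply]; omega)

end IsAdaptedFamily

/-- An element of a dihedral parabolic subgroup not having `i` as a right descent is an alternating
product ending in `j`. -/
theorem CoxeterSystem.exists_eq_wordProd_alternatingWord (cs : CoxeterSystem M W) {d : W} {i j : B}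
    (hd : d ∈ Subgroup.closure {cs.simple i, cs.simple j})
    (h : cs.length d < cs.length (d * cs.simple i)) :
    ∃ k, d = cs.wordProd (alternatingWord i j k) ∧ cs.length d = k := by
  induction hn : cs.length d using Nat.strong_induction_on generalizing d i j with
  | _ n ih =>
  by_cases h1 : d = 1
  · exact ⟨0, by simp [h1, alternatingWord], by simp [← hn, h1]⟩
  have hsub : {cs.simple i, cs.simple j} ⊆ Set.range cs.simple := by
    rintro _ (rfl | rfl) <;> exact ⟨_, rfl⟩
  obtain ⟨s, hs, hlt⟩ := cs.exists_descent_of_mem_closure hsub hd h1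
  have hmem := mul_mem hd (Subgroup.subset_closure hs)
  rcases hs with rfl | rfl
  · omega
  have hlt' := length_mul_simple_of_lt hlt
  rw [Set.pair_comm] at hmem
  obtain ⟨k, hk, hk'⟩ := ih _ (hn ▸ hlt) hmem
    (by rwa [cs.simple_mul_simple_cancel_right]) rfl
  refine ⟨k + 1, ?_, by omega⟩
  rw [alternatingWord_succ, wordProd_concat, ← hk, cs.simple_mul_simple_cancel_right]

theorem CoxeterSystem.length_map (cs : CoxeterSystem M W) {H : Type*} [Group H] (e : W ≃* H)
    (x : W) : (cs.map e).length (e x) = cs.length x := by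
  have hprod : ∀ ω, (cs.map e).wordProd ω = e (cs.wordProd ω) := fun ω => by
    simp [wordProd, map_list_prod, Function.comp_def]
    rfl
  apply le_antisymm
  · obtain ⟨ω, hω, rfl⟩ := cs.exists_isReduced x
    rw [← hprod, hω]
    exact (cs.map e).length_wordProd_le ω
  · obtain ⟨ω, hω, hx⟩ := (cs.map e).exists_isReduced (e x)
    rw [hx, hω]
    rw [hprod, e.apply_eq_iff_eq] at hx
    rw [hx]
    exact cs.length_wordProd_le ω

namespace IsAdaptedFamily

variable {cs : CoxeterSystem M W} {G : Subgroup W} {O : Type*} {K : O → Set W} {w : O → G}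
  [Finite W]

theorem hom_ascent (h : IsAdaptedFamily cs G K w) (g : h.coxeterMatrix.Group) (I : O)
    (hg : h.coxeterSystem.length g < h.coxeterSystem.length (g * h.coxeterSystem.simple I)) :
    ∀ s ∈ K I, cs.length (h.hom g : W) < cs.length (h.hom g * s) := by
  induction hn : h.coxeterSystem.length g using Nat.strong_induction_on generalizing g I with
  | _ n ih =>
  by_cases h1 : g = 1
  · intro s hs
    obtain ⟨i, rfl⟩ := h.subset I hs
    simp [h1]
  obtain ⟨J, hJ⟩ := h.coxeterSystem.exists_rightDescent_of_ne_one h1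
  have hsub : {h.coxeterSystem.simple I, h.coxeterSystem.simple J} ⊆
      Set.range h.coxeterSystem.simple := by
    rintro _ (rfl | rfl) <;> exact ⟨_, rfl⟩
  obtain ⟨g', d, hd, rfl, hadd⟩ := h.coxeterSystem.exists_eq_mul_of_closure hsub g
  have hI := Subgroup.subset_closure
    (show h.coxeterSystem.simple I ∈ {h.coxeterSystem.simple I, h.coxeterSystem.simple J} by simp)
  have hJ' := Subgroup.subset_closure
    (show h.coxeterSystem.simple J ∈ {h.coxeterSystem.simple I, h.coxeterSystem.simple J} by simp)
  rw [mul_assoc, hadd _ hd, hadd _ (mul_mem hd hI)] at hg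
  rw [IsRightDescent, mul_assoc, hadd _ hd, hadd _ (mul_mem hd hJ')] at hJ
  rw [hadd _ hd] at hn
  have hI1 := h.coxeterSystem.length_simple I
  have hJ1 := h.coxeterSystem.length_simple J
  have hgI := ih _ (by omega) g' I (by rw [hadd _ hI]; omega) rfl
  have hgJ := ih _ (by omega) g' J (by rw [hadd _ hJ']; omega) rfl
  obtain ⟨k, rfl, hk⟩ := h.coxeterSystem.exists_eq_wordProd_alternatingWord hd (by omega)
  have hkM : k < h.coxeterMatrix I J := by
    by_contra hkM
    refine h.coxeterSystem.not_isReduced_alternatingWord J I (m := k + 1)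
      (h.coxeterMatrix_ne_zero J I) (by rw [h.coxeterMatrix.symmetric]; omega) ?_
    rw [CoxeterSystem.IsReduced, alternatingWord_succ, wordProd_concat, List.length_concat,
      length_alternatingWord]
    rcases h.coxeterSystem.length_mul_simple
      (h.coxeterSystem.wordProd (alternatingWord I J k)) I with h2 | h2 <;> omega
  intro s hs
  have key : ∀ x ∈ Subgroup.closure (K I ∪ K J),
      cs.length (h.hom g' * x) = cs.length (h.hom g' : W) + cs.length x := fun x hx =>
    cs.length_mul_of_mem_closure (Set.union_subset (h.subset I) (h.subset J))
      (fun s hs => hs.elim (hgI s) (hgJ s)) hx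
  have hmem := h.alternating_mem_closure I J k
  have hasc := h.alternating_ascent k I J hkM s hs
  have e : h.hom (g' * h.coxeterSystem.wordProd (alternatingWord I J k)) =
      h.hom g' * h.alternating I J k := map_mul _ _ _
  rw [e, Subgroup.coe_mul, mul_assoc, key _ hmem, key _ (mul_mem hmem
    (Subgroup.subset_closure (Or.inl hs)))]
  omega

theorem length_hom_mul_simple (h : IsAdaptedFamily cs G K w) {g : h.coxeterMatrix.Group} {I : O}
    (hg : h.coxeterSystem.length g < h.coxeterSystem.length (g * h.coxeterSystem.simple I)) :
    cs.length (h.hom (g * h.coxeterSystem.simple I) : W) =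
      cs.length (h.hom g : W) + cs.length (w I : W) := by
  rw [map_mul, hom_simple, Subgroup.coe_mul, h.length_mul_of_ascent (h.hom_ascent g I hg)]

theorem hom_injective (h : IsAdaptedFamily cs G K w) : Function.Injective h.hom := by
  rw [injective_iff_map_eq_one]
  intro g hg
  by_contra h1
  obtain ⟨J, hJ⟩ := h.coxeterSystem.exists_rightDescent_of_ne_one h1
  have := h.length_hom_mul_simple (g := g * h.coxeterSystem.simple J) (I := J)
    (by rwa [simple_mul_simple_cancel_right])
  rw [simple_mul_simple_cancel_right, hg, Subgroup.coe_one, length_one] at this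
  have := h.length_pos J
  omega

theorem hom_surjective (h : IsAdaptedFamily cs G K w) : Function.Surjective h.hom := by
  intro x
  induction hn : cs.length (x : W) using Nat.strong_induction_on generalizing x with
  | _ n ih =>
  by_cases h1 : (x : W) = 1
  · exact ⟨1, by rw [map_one]; exact Subtype.ext h1.symm⟩
  obtain ⟨i, hi⟩ := cs.exists_rightDescent_of_ne_one h1
  obtain ⟨I, hI⟩ : ∃ I, cs.simple i ∈ K I := Set.mem_iUnion.1 (h.iUnion_eq ▸ ⟨i, rfl⟩)
  have hlen := h.length_mul_of_descent (h.descent x I _ hI hi)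
  have hpos := h.length_pos I
  obtain ⟨g, hg⟩ := ih _ (by rw [Subgroup.coe_mul]; omega) (x * w I) rfl
  exact ⟨g * h.coxeterSystem.simple I, by
    rw [map_mul, hg, hom_simple, mul_assoc, h.mul_self, mul_one]⟩

theorem length_mul_eq_iff (h : IsAdaptedFamily cs G K w) (u v : h.coxeterMatrix.Group) :
    h.coxeterSystem.length (u * v) = h.coxeterSystem.length u + h.coxeterSystem.length v ↔
      cs.length (h.hom u * h.hom v : W) = cs.length (h.hom u : W) + cs.length (h.hom v : W) := by
  induction hn : h.coxeterSystem.length v using Nat.strong_induction_on generalizing v with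
  | _ n ih =>
  by_cases h1 : v = 1
  · simp [h1, ← hn]
  obtain ⟨J, hJ⟩ := h.coxeterSystem.exists_rightDescent_of_ne_one h1
  obtain ⟨v, rfl⟩ : ∃ v', v = v' * h.coxeterSystem.simple J :=
    ⟨v * h.coxeterSystem.simple J, by rw [simple_mul_simple_cancel_right]⟩
  rw [IsRightDescent, simple_mul_simple_cancel_right] at hJ
  have hv := ih _ (hn ▸ hJ) v rfl
  have hvJ := h.length_hom_mul_simple hJ
  have hle := cs.length_mul_le (h.hom u * h.hom v : W) (w J)
  have hle' := cs.length_mul_le (h.hom u : W) (h.hom v)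
  have hle'' := h.coxeterSystem.length_mul_le u v
  have hpos := h.length_pos J
  have e : (h.hom u * h.hom (v * h.coxeterSystem.simple J) : W) = h.hom u * h.hom v * w J := by
    rw [map_mul, hom_simple, Subgroup.coe_mul, mul_assoc]
  rw [hvJ, e, ← mul_assoc]
  have h2 := h.coxeterSystem.length_mul_simple v J
  rcases h.coxeterSystem.length_mul_simple (u * v) J with h3 | h3
  · have h4 := h.length_hom_mul_simple (g := u * v) (I := J) (by omega)
    simp only [map_mul, hom_simple, Subgroup.coe_mul] at h4
    omega
  · have h4 := h.length_hom_mul_simple (g := u * v * h.coxeterSystem.simple J) (I := J)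
      (by rw [simple_mul_simple_cancel_right]; omega)
    rw [simple_mul_simple_cancel_right] at h4
    simp only [map_mul, hom_simple, Subgroup.coe_mul] at h4
    omega

/-- The subgroup `G` is a Coxeter group on the longest elements `w I`. -/
theorem exists_coxeterSystem (h : IsAdaptedFamily cs G K w) :
    ∃ (M' : CoxeterMatrix O) (cs' : CoxeterSystem M' G), (∀ I, cs'.simple I = w I) ∧
      ∀ u v : G, cs'.length (u * v) = cs'.length u + cs'.length v ↔
        cs.length (u * v : W) = cs.length (u : W) + cs.length (v : W) := by
  let e := MulEquiv.ofBijective h.hom ⟨h.hom_injective, h.hom_surjective⟩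
  refine ⟨h.coxeterMatrix, h.coxeterSystem.map e, fun I => h.hom_simple I, fun u v => ?_⟩
  obtain ⟨u, rfl⟩ := e.surjective u
  obtain ⟨v, rfl⟩ := e.surjective v
  rw [← map_mul, length_map, length_map, length_map]
  exact h.length_mul_eq_iff u v

end IsAdaptedFamily

section FixedPoints

variable {cs : CoxeterSystem M W} {σ : MulAut W}

theorem zpow_image_eq_of_image_eq {S : Set W} (hσ : σ '' S = S) (n : ℤ) {s : W} (hs : s ∈ S) :
    (σ ^ n) s ∈ S := by
  have h1 : ∀ s ∈ S, σ s ∈ S := fun s hs => hσ ▸ Set.mem_image_of_mem σ hs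
  have h2 : ∀ s ∈ S, σ⁻¹ s ∈ S := fun s hs => by
    obtain ⟨t, ht, rfl⟩ := hσ.symm ▸ hs
    rwa [MulAut.inv_apply_self]
  induction n using Int.induction_on with
  | zero => simpa
  | succ n ih => rw [add_comm, zpow_add, zpow_one, MulAut.mul_apply]; exact h1 _ ih
  | pred n ih =>
    rw [sub_eq_add_neg, add_comm, zpow_add, zpow_neg_one, MulAut.mul_apply]; exact h2 _ ih

theorem length_apply_le (hσ : σ '' simpleSet cs = simpleSet cs) (x : W) :
    cs.length (σ x) ≤ cs.length x := by
  obtain ⟨ω, hω, rfl⟩ := cs.exists_isReduced x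
  rw [hω]
  clear hω
  induction ω with
  | nil => simp
  | cons i ω ih =>
    obtain ⟨j, hj⟩ : σ (cs.simple i) ∈ simpleSet cs := hσ ▸ Set.mem_image_of_mem σ ⟨i, rfl⟩
    have := cs.length_mul_le (σ (cs.simple i)) (σ (cs.wordProd ω))
    rw [cs.wordProd_cons, map_mul, List.length_cons]
    rw [← hj, cs.length_simple, hj] at this
    omega

theorem length_zpow_apply (hσ : σ '' simpleSet cs = simpleSet cs) (n : ℤ) (x : W) :
    cs.length ((σ ^ n) x) = cs.length x := by
  have hpow : ∀ n : ℤ, (σ ^ n) '' simpleSet cs = simpleSet cs := fun n => by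
    refine Set.Subset.antisymm ?_ fun s hs => ⟨(σ ^ (-n)) s, zpow_image_eq_of_image_eq hσ _ hs, ?_⟩
    · rintro _ ⟨s, hs, rfl⟩
      exact zpow_image_eq_of_image_eq hσ n hs
    · rw [← MulAut.mul_apply, ← zpow_add, add_neg_cancel, zpow_zero, MulAut.one_apply]
  refine le_antisymm (length_apply_le (hpow n) x) ?_
  have := length_apply_le (hpow (-n)) ((σ ^ n) x)
  rwa [← MulAut.mul_apply, ← zpow_add, neg_add_cancel, zpow_zero, MulAut.one_apply] at this

theorem zpow_apply_of_mem_fixedSubgroup {x : W} (hx : x ∈ fixedSubgroup σ) (n : ℤ) :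
    (σ ^ n) x = x := by
  have h : σ ∈ MulAction.stabilizer (MulAut W) x := hx
  exact zpow_mem h n

namespace IsOrbit

variable {I J : Set W}

theorem nonempty (hI : IsOrbit cs σ I) : I.Nonempty := by
  obtain ⟨s, -, rfl⟩ := hI
  exact ⟨s, 0, by simp⟩

theorem subset_simpleSet (hσ : σ '' simpleSet cs = simpleSet cs) (hI : IsOrbit cs σ I) :
    I ⊆ simpleSet cs := by
  obtain ⟨s, hs, rfl⟩ := hI
  rintro _ ⟨n, rfl⟩
  exact zpow_image_eq_of_image_eq hσ n hs

theorem eq_setOf (hI : IsOrbit cs σ I) {s : W} (hs : s ∈ I) :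
    I = {w | ∃ n : ℤ, (σ ^ n) s = w} := by
  obtain ⟨t, -, rfl⟩ := hI
  obtain ⟨m, rfl⟩ := hs
  ext w
  constructor
  · rintro ⟨n, rfl⟩
    exact ⟨n - m, by rw [← MulAut.mul_apply, ← zpow_add, sub_add_cancel]⟩
  · rintro ⟨n, rfl⟩
    exact ⟨n + m, by rw [zpow_add, MulAut.mul_apply]⟩

theorem apply_mem (hI : IsOrbit cs σ I) {s : W} (hs : s ∈ I) : σ s ∈ I := by
  rw [hI.eq_setOf hs]
  exact ⟨1, by simp⟩

end IsOrbit

theorem IsLongestIn.mem_fixedSubgroup (hσ : σ '' simpleSet cs = simpleSet cs) {I : Set W}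
    (hI : IsOrbit cs σ I) {u : W} (hu : IsLongestIn cs I u) : u ∈ fixedSubgroup σ := by
  have hlen : cs.length (σ u) = cs.length u := by simpa using length_zpow_apply hσ 1 u
  have hmap : σ u ∈ Subgroup.closure I := by
    have : (Subgroup.closure I).map σ.toMonoidHom ≤ Subgroup.closure I := by
      rw [MonoidHom.map_closure, Subgroup.closure_le]
      rintro _ ⟨s, hs, rfl⟩
      exact Subgroup.subset_closure (hI.apply_mem hs)
    exact this (Subgroup.mem_map_of_mem σ.toMonoidHom hu.1)
  exact IsLongestIn.eq (cs := cs) (K := I) ⟨hmap, fun v hv => hlen ▸ hu.2 v hv⟩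
    (hI.subset_simpleSet hσ) hu

theorem isAdaptedFamily_fixedSubgroup (hσ : σ '' simpleSet cs = simpleSet cs)
    (w : {I : Set W // IsOrbit cs σ I} → fixedSubgroup σ)
    (hw : ∀ I, IsLongestIn cs I.1 (w I : W)) :
    IsAdaptedFamily cs (fixedSubgroup σ) (fun I : {I : Set W // IsOrbit cs σ I} => I.1) w where
  iUnion_eq := by
    refine Set.Subset.antisymm (Set.iUnion_subset fun I => I.2.subset_simpleSet hσ) fun s hs => ?_
    exact Set.mem_iUnion.2 ⟨⟨_, s, hs, rfl⟩, 0, by simp⟩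
  nonempty I := I.2.nonempty
  isLongestIn := hw
  injective I J hIJ := by
    obtain ⟨s, hs⟩ := J.2.nonempty
    obtain ⟨i, rfl⟩ := J.2.subset_simpleSet hσ hs
    have h1 := (hw J).length_mul_lt (J.2.subset_simpleSet hσ) hs
    rw [← hIJ] at h1
    have h2 := cs.simple_mem_of_mem_closure (I.2.subset_simpleSet hσ)
      (cs.mem_closure_of_length_mul_lt (I.2.subset_simpleSet hσ) (hw I).1
        (cs.isReflection_simple i) h1)
    exact Subtype.ext ((I.2.eq_setOf h2).trans (J.2.eq_setOf hs).symm)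
  descent x I s hs hlt s' hs' := by
    rw [I.2.eq_setOf hs] at hs'
    obtain ⟨n, rfl⟩ := hs'
    have := length_zpow_apply hσ n (x * s)
    rw [map_mul, zpow_apply_of_mem_fixedSubgroup x.2] at this
    rwa [this]

end FixedPoints

/-- Let `σ` be an automorphism of the finite Coxeter system `(W, S)`,
i.e. a group automorphism of `W` with `σ(S) = S`, and for each orbit `I` of `σ` on `S`
let `w₀^I` be the longest element of `W_I`. Then `(W^σ, {w₀^I}_{I ∈ S/σ})` is
a Coxeter system, whose length function `l'` satisfies, for all `u, v ∈ W^σ`: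
`l'(uv) = l'(u) + l'(v)` if and only if `l(uv) = l(u) + l(v)`. -/
theorem stmt2 [Finite W] (cs : CoxeterSystem M W) (σ : MulAut W)
    (hσ : σ '' simpleSet cs = simpleSet cs)
    (w0 : Set W → W) (hw0 : ∀ I : Set W, IsOrbit cs σ I → IsLongestIn cs I (w0 I)) :
    ∃ (M' : CoxeterMatrix {I : Set W // IsOrbit cs σ I})
      (cs' : CoxeterSystem M' (fixedSubgroup σ)),
      (∀ I : {I : Set W // IsOrbit cs σ I},
        ((cs'.simple I : fixedSubgroup σ) : W) = w0 I.1) ∧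
      (∀ u v : fixedSubgroup σ,
        cs'.length (u * v) = cs'.length u + cs'.length v ↔
          cs.length ((u : W) * (v : W)) = cs.length (u : W) + cs.length (v : W)) := by

  have hfam := isAdaptedFamily_fixedSubgroup hσ
    (fun I => ⟨w0 I.1, (hw0 I.1 I.2).mem_fixedSubgroup hσ I.2⟩) (fun I => hw0 I.1 I.2)
  obtain ⟨M', cs', h1, h2⟩ := hfam.exists_coxeterSystem
  exact ⟨M', cs', fun I => congrArg Subtype.val (h1 I), h2⟩
end
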